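/- Let N ≥ 1 and 0 ≤ δ < ρ ≤ 1. Let σ : ℝ^N × ℝ^N → ℂ be a symbol of class S^0_{ρ,δ}(ℝ^N × ℝ^N) and suppose there is a compact set K₀ ⊆ ℝ^N such that σ(x,ξ) = 0 whenever x ∉ K₀. Then there exists a constant C ≥ 0 such that for every Schwartz function f ∈ 𝒮(ℝ^N), ‖A_σ f‖_{L²(ℝ^N)} ≤ C ‖f‖_{L²(ℝ^N)}; consequently A_σ extends uniquely to a bounded linear operator on L²(ℝ^N). (First part of Proposition 5.2 of the paper, the L² boundedness of compactly supported order-zero operators, via Hörmander's 'very simple proof of L² continuity'.) -/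

import Mathlib

open MeasureTheory Filter

/-- Partial derivative of a symbol `a(x, θ)` in the `i`-th coordinate of the
spatial variable `x`. -/
noncomputable def pdX {n N : ℕ} (i : Fin n)
    (a : (Fin n → ℝ) → (Fin N → ℝ) → ℂ) : (Fin n → ℝ) → (Fin N → ℝ) → ℂ :=
  fun x θ => fderiv ℝ (fun x' => a x' θ) x (Pi.single i 1)

/-- Partial derivative of a symbol `a(x, θ)` in the `i`-th coordinate of the
frequency variable `θ`. -/
noncomputable def pdTheta {n N : ℕ} (i : Fin N)
    (a : (Fin n → ℝ) → (Fin N → ℝ) → ℂ) : (Fin n → ℝ) → (Fin N → ℝ) → ℂ :=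
  fun x θ => fderiv ℝ (fun θ' => a x θ') θ (Pi.single i 1)

/-- The iterated partial derivative `∂^α_θ ∂^β_x a` of a symbol, where the multi-indices
`α`, `β` are recorded as lists `Lθ`, `Lx` of coordinate directions (the length of the list
is the total order `|α|`, resp. `|β|`, of the multi-index). -/
noncomputable def symbolDeriv {n N : ℕ} (Lx : List (Fin n)) (Lθ : List (Fin N))
    (a : (Fin n → ℝ) → (Fin N → ℝ) → ℂ) : (Fin n → ℝ) → (Fin N → ℝ) → ℂ :=
  Lx.foldr pdX (Lθ.foldr pdTheta a)

/-- The japanese-bracket weight `⟨θ⟩^s = (1 + |θ|²)^(s/2)`. -/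
noncomputable def jweight {N : ℕ} (s : ℝ) (θ : Fin N → ℝ) : ℝ :=
  (1 + ‖θ‖ ^ 2) ^ (s / 2 : ℝ)

/-- The Hörmander class `S^m_{ρ,δ}(W × ℝ^N)`: `a` is smooth on `W × ℝ^N` and every iterated
derivative `∂^α_θ ∂^β_x a` is bounded on `K × ℝ^N` (`K ⊆ W` compact) by a constant times
`⟨θ⟩^(m - ρ|α| + δ|β|)`. -/
def IsHormanderSymbol {n N : ℕ} (ρ δ m : ℝ) (W : Set (Fin n → ℝ))
    (a : (Fin n → ℝ) → (Fin N → ℝ) → ℂ) : Prop :=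
  ContDiffOn ℝ (⊤ : ℕ∞) (fun p : (Fin n → ℝ) × (Fin N → ℝ) => a p.1 p.2) (W ×ˢ Set.univ) ∧
  ∀ K : Set (Fin n → ℝ), K ⊆ W → IsCompact K →
    ∀ (Lx : List (Fin n)) (Lθ : List (Fin N)), ∃ C : ℝ, 0 ≤ C ∧
      ∀ x ∈ K, ∀ θ : Fin N → ℝ,
        ‖symbolDeriv Lx Lθ a x θ‖ ≤
          C * jweight (m - ρ * (Lθ.length : ℝ) + δ * (Lx.length : ℝ)) θ

/-- A continuous family over `T` with values in `S^m_{ρ,δ}(W × ℝ^N)` : each `a t` lies in the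
class, and `t ↦ a t` is continuous for the Fréchet seminorm topology, i.e. for each `t₀`,
compact `K ⊆ W` and multi-indices, the corresponding seminorm of `a t - a t₀` is eventually
smaller than any `ε > 0`. -/
def IsContinuousSymbolFamily {T : Type*} [TopologicalSpace T] {n N : ℕ}
    (ρ δ m : ℝ) (W : Set (Fin n → ℝ))
    (a : T → (Fin n → ℝ) → (Fin N → ℝ) → ℂ) : Prop :=
  (∀ t, IsHormanderSymbol ρ δ m W (a t)) ∧
  ∀ t₀ : T, ∀ K : Set (Fin n → ℝ), K ⊆ W → IsCompact K →
    ∀ (Lx : List (Fin n)) (Lθ : List (Fin N)), ∀ ε : ℝ, 0 < ε →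
      ∀ᶠ t in nhds t₀, ∀ x ∈ K, ∀ θ : Fin N → ℝ,
        ‖symbolDeriv Lx Lθ (fun x' θ' => a t x' θ' - a t₀ x' θ') x θ‖ ≤
          ε * jweight (m - ρ * (Lθ.length : ℝ) + δ * (Lx.length : ℝ)) θ

/-- The dot product `x · ξ = ∑ i, x i * ξ i` on `ℝ^N`. -/
noncomputable def dotProd {N : ℕ} (x ξ : Fin N → ℝ) : ℝ := ∑ i, x i * ξ i

/-- The Fourier transform `𝓕 f (ξ) = ∫ e^{-2πi y·ξ} f(y) dy`. -/
noncomputable def fourierT {N : ℕ} (f : (Fin N → ℝ) → ℂ) (ξ : Fin N → ℝ) : ℂ :=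
  ∫ y : Fin N → ℝ, Complex.exp (-(2 * (Real.pi : ℂ) * Complex.I * (dotProd y ξ : ℂ))) * f y

/-- The pseudodifferential operator with symbol `σ`:
`A_σ f (x) = ∫ e^{2πi x·ξ} σ(x,ξ) 𝓕f(ξ) dξ`. -/
noncomputable def pdoApply {N : ℕ} (σ : (Fin N → ℝ) → (Fin N → ℝ) → ℂ)
    (f : (Fin N → ℝ) → ℂ) (x : Fin N → ℝ) : ℂ :=
  ∫ ξ : Fin N → ℝ,
    Complex.exp (2 * (Real.pi : ℂ) * Complex.I * (dotProd x ξ : ℂ)) * σ x ξ * fourierT f ξ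

open scoped FourierTransform SchwartzMap ContDiff

/-- Plancherel: the Fourier integral of a function in `L¹ ∩ L²` represents its `L²` Fourier
transform, hence has the same norm. -/
theorem eLpNorm_fourier_eq_of_integrable {V : Type*} [NormedAddCommGroup V]
    [InnerProductSpace ℝ V] [FiniteDimensional ℝ V] [MeasurableSpace V] [BorelSpace V]
    {g : V → ℂ} (hg : Integrable g) (hg2 : MemLp g 2) :
    eLpNorm (𝓕 g) 2 volume = eLpNorm g 2 volume := by
  set G : Lp ℂ 2 (volume : MeasureTheory.Measure V) := 𝓕 (hg2.toLp g) with hG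
  have hcont : Continuous (𝓕 g) :=
    VectorFourier.fourierIntegral_continuous Real.continuous_fourierChar
      (by exact continuous_inner) hg
  have hae : ∀ᵐ x ∂(volume : MeasureTheory.Measure V), 𝓕 g x = G x := by
    refine ae_eq_of_integral_contDiff_smul_eq hcont.locallyIntegrable
      ((Lp.memLp G).locallyIntegrable (by norm_num)) fun φ hφ hφc => ?_
    have hc : HasCompactSupport fun x => (φ x : ℂ) := hφc.comp_left (g := Complex.ofReal) rfl
    have hs : ContDiff ℝ ∞ fun x => (φ x : ℂ) := Complex.ofRealCLM.contDiff.comp hφ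
    set Φ : 𝓢(V, ℂ) := hc.toSchwartzMap hs with hΦ
    have h1 : ∫ x, (𝓕 Φ) x • (hg2.toLp g) x = ∫ x, Φ x • G x := by
      rw [← Lp.toTemperedDistribution_apply, ← Lp.toTemperedDistribution_apply, hG,
        ← Lp.fourier_toTemperedDistribution_eq, TemperedDistribution.fourier_apply]
    have h2 : ∫ x, (𝓕 Φ) x • g x = ∫ x, Φ x • 𝓕 g x := by
      have := VectorFourier.integral_fourierIntegral_smul_eq_flip (L := innerₗ V)
        (μ := volume) (ν := volume) Real.continuous_fourierChar continuous_inner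
        Φ.integrable hg
      rw [flip_innerₗ] at this
      rw [SchwartzMap.fourier_coe]
      exact this
    have h3 : ∫ x, (𝓕 Φ) x • (hg2.toLp g) x = ∫ x, (𝓕 Φ) x • g x := by
      refine integral_congr_ae ?_
      filter_upwards [hg2.coeFn_toLp] with x hx
      rw [hx]
    calc ∫ x, φ x • 𝓕 g x = ∫ x, Φ x • 𝓕 g x := by
          simp [hΦ, Complex.real_smul]
      _ = ∫ x, Φ x • G x := by rw [← h2, ← h3, h1]
      _ = ∫ x, φ x • G x := by simp [hΦ, Complex.real_smul]
  rw [eLpNorm_congr_ae hae, ← Lp.enorm_def, hG, ← eLpNorm_congr_ae hg2.coeFn_toLp, ← Lp.enorm_def,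
    ← ofReal_norm, ← ofReal_norm, Lp.norm_fourier_eq]

theorem fourierT_eq_fourier {N : ℕ} (f : (Fin N → ℝ) → ℂ) (ξ : Fin N → ℝ) :
    fourierT f ξ =
      𝓕 (fun v : EuclideanSpace ℝ (Fin N) => f (WithLp.ofLp v)) (WithLp.toLp 2 ξ) := by
  rw [Real.fourier_eq', fourierT, ← (PiLp.volume_preserving_ofLp (Fin N)).integral_comp
    (MeasurableEquiv.toLp 2 (Fin N → ℝ)).symm.measurableEmbedding]
  refine integral_congr_ae (ae_of_all _ fun v => ?_)
  simp only [smul_eq_mul, dotProd, PiLp.inner_apply]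
  congr 2
  push_cast
  simp only [RCLike.inner_apply, conj_trivial, Complex.ofReal_mul, mul_comm (Complex.ofReal (ξ _))]
  ring

theorem eLpNorm_fourierT {N : ℕ} {g : (Fin N → ℝ) → ℂ} (hg : Integrable g) (hg2 : MemLp g 2) :
    eLpNorm (fourierT g) 2 volume = eLpNorm g 2 volume := by
  have hp := PiLp.volume_preserving_ofLp (Fin N)
  have hp' := PiLp.volume_preserving_toLp (Fin N)
  have h := eLpNorm_fourier_eq_of_integrable (V := EuclideanSpace ℝ (Fin N))
    (g := fun v => g (WithLp.ofLp v))
    (hp.integrable_comp_of_integrable hg) (hg2.comp_measurePreserving hp)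
  have hc : Continuous (𝓕 (fun v : EuclideanSpace ℝ (Fin N) => g (WithLp.ofLp v))) :=
    VectorFourier.fourierIntegral_continuous Real.continuous_fourierChar
      (by exact continuous_inner) (hp.integrable_comp_of_integrable hg)
  have e1 : fourierT g = 𝓕 (fun v : EuclideanSpace ℝ (Fin N) => g (WithLp.ofLp v)) ∘
      (WithLp.toLp 2) := funext fun ξ => fourierT_eq_fourier g ξ
  rw [e1, eLpNorm_comp_measurePreserving hc.aestronglyMeasurable hp', h]
  exact eLpNorm_comp_measurePreserving hg.aestronglyMeasurable hp

theorem continuous_fourierT {N : ℕ} {g : (Fin N → ℝ) → ℂ} (hg : Integrable g) :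
    Continuous (fourierT g) := by
  have hp := PiLp.volume_preserving_ofLp (Fin N)
  have hc : Continuous (𝓕 (fun v : EuclideanSpace ℝ (Fin N) => g (WithLp.ofLp v))) :=
    VectorFourier.fourierIntegral_continuous Real.continuous_fourierChar
      (by exact continuous_inner) (hp.integrable_comp_of_integrable hg)
  have e1 : fourierT g = 𝓕 (fun v : EuclideanSpace ℝ (Fin N) => g (WithLp.ofLp v)) ∘
      (WithLp.toLp 2) := funext fun ξ => fourierT_eq_fourier g ξ
  rw [e1]
  exact hc.comp (PiLp.continuous_toLp 2 _)

theorem integrable_fourierT {N : ℕ} (f : 𝓢(Fin N → ℝ, ℂ)) : Integrable (fourierT ⇑f) := by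
  have hp' := PiLp.volume_preserving_toLp (Fin N)
  set F : 𝓢(EuclideanSpace ℝ (Fin N), ℂ) := SchwartzMap.compCLMOfContinuousLinearEquiv ℝ
    (EuclideanSpace.equiv (Fin N) ℝ) f with hF
  have e1 : fourierT ⇑f = ⇑(𝓕 F : 𝓢(EuclideanSpace ℝ (Fin N), ℂ)) ∘ (WithLp.toLp 2) := by
    funext ξ
    rw [fourierT_eq_fourier, SchwartzMap.fourier_coe]
    rfl
  rw [e1]
  exact hp'.integrable_comp_of_integrable
    (𝓕 F : 𝓢(EuclideanSpace ℝ (Fin N), ℂ)).integrable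

/-- The inverse Fourier integral `∫ e^{2πi x·ξ} g(ξ) dξ`. -/
noncomputable def invFourierT {N : ℕ} (g : (Fin N → ℝ) → ℂ) (x : Fin N → ℝ) : ℂ :=
  ∫ ξ : Fin N → ℝ, Complex.exp (2 * (Real.pi : ℂ) * Complex.I * (dotProd x ξ : ℂ)) * g ξ

theorem invFourierT_eq {N : ℕ} (g : (Fin N → ℝ) → ℂ) (x : Fin N → ℝ) :
    invFourierT g x = fourierT g (-x) := by
  unfold invFourierT fourierT
  congr 1
  funext ξ
  congr 2
  simp only [dotProd, Pi.neg_apply]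
  push_cast
  simp [mul_comm]

theorem eLpNorm_invFourierT {N : ℕ} {g : (Fin N → ℝ) → ℂ} (hg : Integrable g)
    (hg2 : MemLp g 2) : eLpNorm (invFourierT g) 2 volume = eLpNorm g 2 volume := by
  have e1 : invFourierT g = fourierT g ∘ Neg.neg := funext fun x => invFourierT_eq g x
  rw [e1, eLpNorm_comp_measurePreserving (continuous_fourierT hg).aestronglyMeasurable
    (Measure.measurePreserving_neg volume), eLpNorm_fourierT hg hg2]

theorem continuous_invFourierT {N : ℕ} {g : (Fin N → ℝ) → ℂ} (hg : Integrable g) :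
    Continuous (invFourierT g) := by
  have e1 : invFourierT g = fourierT g ∘ Neg.neg := funext fun x => invFourierT_eq g x
  rw [e1]
  exact (continuous_fourierT hg).comp continuous_neg

section SymbolDerivatives

variable {n N : ℕ} {a : (Fin n → ℝ) → (Fin N → ℝ) → ℂ}

theorem contDiff_pdX (i : Fin n)
    (ha : ContDiff ℝ ∞ fun p : (Fin n → ℝ) × (Fin N → ℝ) => a p.1 p.2) :
    ContDiff ℝ ∞ fun p : (Fin n → ℝ) × (Fin N → ℝ) => pdX i a p.1 p.2 := by
  unfold pdX
  refine ContDiff.fderiv_apply (m := ∞) (n := ∞)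
    (f := fun (p : (Fin n → ℝ) × (Fin N → ℝ)) x' => a x' p.2) ?_ contDiff_fst contDiff_const le_rfl
  exact ha.comp (contDiff_snd.prodMk (contDiff_snd.comp contDiff_fst))

theorem contDiff_pdTheta (i : Fin N)
    (ha : ContDiff ℝ ∞ fun p : (Fin n → ℝ) × (Fin N → ℝ) => a p.1 p.2) :
    ContDiff ℝ ∞ fun p : (Fin n → ℝ) × (Fin N → ℝ) => pdTheta i a p.1 p.2 := by
  unfold pdTheta
  refine ContDiff.fderiv_apply (m := ∞) (n := ∞)
    (f := fun (p : (Fin n → ℝ) × (Fin N → ℝ)) θ' => a p.1 θ') ?_ contDiff_snd contDiff_const le_rfl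
  exact ha.comp ((contDiff_fst.comp contDiff_fst).prodMk contDiff_snd)

theorem contDiff_symbolDeriv (Lx : List (Fin n)) (Lθ : List (Fin N))
    (ha : ContDiff ℝ ∞ fun p : (Fin n → ℝ) × (Fin N → ℝ) => a p.1 p.2) :
    ContDiff ℝ ∞ fun p : (Fin n → ℝ) × (Fin N → ℝ) => symbolDeriv Lx Lθ a p.1 p.2 := by
  unfold symbolDeriv
  induction Lx with
  | nil =>
    induction Lθ with
    | nil => exact ha
    | cons i L ih => exact contDiff_pdTheta i ih
  | cons i L ih => exact contDiff_pdX i ih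

theorem pdX_eq_zero_of_notMem {K : Set (Fin n → ℝ)} (hK : IsClosed K) (i : Fin n)
    (ha : ∀ x, x ∉ K → ∀ θ, a x θ = 0) : ∀ x, x ∉ K → ∀ θ, pdX i a x θ = 0 := by
  intro x hx θ
  have : (fun x' => a x' θ) =ᶠ[nhds x] fun _ => 0 := by
    filter_upwards [hK.isOpen_compl.mem_nhds hx] with y hy using ha y hy θ
  simp [pdX, this.fderiv_eq]

theorem pdTheta_eq_zero_of_notMem {K : Set (Fin n → ℝ)} (i : Fin N)
    (ha : ∀ x, x ∉ K → ∀ θ, a x θ = 0) : ∀ x, x ∉ K → ∀ θ, pdTheta i a x θ = 0 := by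
  intro x hx θ
  simp [pdTheta, ha x hx]

theorem symbolDeriv_eq_zero_of_notMem {K : Set (Fin n → ℝ)} (hK : IsClosed K)
    (Lx : List (Fin n)) (Lθ : List (Fin N)) (ha : ∀ x, x ∉ K → ∀ θ, a x θ = 0) :
    ∀ x, x ∉ K → ∀ θ, symbolDeriv Lx Lθ a x θ = 0 := by
  unfold symbolDeriv
  induction Lx with
  | nil =>
    induction Lθ with
    | nil => exact ha
    | cons i L ih => exact pdTheta_eq_zero_of_notMem i ih
  | cons i L ih => exact pdX_eq_zero_of_notMem hK i ih

end SymbolDerivatives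

section KernelDecay

variable {N : ℕ}

theorem continuous_dotProd : Continuous fun p : (Fin N → ℝ) × (Fin N → ℝ) => dotProd p.1 p.2 := by
  unfold dotProd
  fun_prop

/-- The character `e^{2πi x·ζ}`. -/
noncomputable def charE (x ζ : Fin N → ℝ) : ℂ :=
  Complex.exp (2 * (Real.pi : ℂ) * Complex.I * (dotProd x ζ : ℂ))

theorem charE_eq (x ζ : Fin N → ℝ) :
    charE x ζ = Complex.exp (((2 * Real.pi * dotProd x ζ : ℝ) : ℂ) * Complex.I) := by
  unfold charE
  push_cast
  ring_nf

@[simp]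
theorem norm_charE (x ζ : Fin N → ℝ) : ‖charE x ζ‖ = 1 := by
  rw [charE_eq, Complex.norm_exp_ofReal_mul_I]

theorem continuous_charE : Continuous fun p : (Fin N → ℝ) × (Fin N → ℝ) => charE p.1 p.2 := by
  unfold charE
  have := continuous_dotProd (N := N)
  fun_prop

theorem hasFDerivAt_charE (x ζ : Fin N → ℝ) :
    HasFDerivAt (fun x => charE x ζ)
      ((charE x ζ * (2 * (Real.pi : ℂ) * Complex.I)) • Complex.ofRealCLM.comp
        (∑ i, ζ i • ContinuousLinearMap.proj (R := ℝ) (φ := fun _ : Fin N => ℝ) i)) x := by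
  have h1 : HasFDerivAt (fun x : Fin N → ℝ => dotProd x ζ)
      (∑ i, ζ i • ContinuousLinearMap.proj (R := ℝ) (φ := fun _ : Fin N => ℝ) i) x := by
    unfold dotProd
    refine HasFDerivAt.fun_sum fun i _ => ?_
    exact (ContinuousLinearMap.proj (R := ℝ) (φ := fun _ : Fin N => ℝ) i).hasFDerivAt.mul_const _
  have h2 := ((Complex.ofRealCLM.hasFDerivAt.comp x h1).const_mul
    (2 * (Real.pi : ℂ) * Complex.I)).cexp
  refine h2.congr_fderiv ?_
  rw [smul_smul]
  rfl

theorem integral_charE_mul_fderiv {K : Set (Fin N → ℝ)} (hK : IsCompact K) (i : Fin N)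
    (ζ : Fin N → ℝ) {f : (Fin N → ℝ) → ℂ} (hf : ContDiff ℝ 1 f) (hf0 : ∀ x, x ∉ K → f x = 0) :
    ∫ x, charE x ζ * fderiv ℝ f x (Pi.single i 1) =
      -(2 * (Real.pi : ℂ) * Complex.I * ζ i) * ∫ x, charE x ζ * f x := by
  have hc : Continuous fun x : Fin N → ℝ => charE x ζ :=
    continuous_charE.comp (continuous_id.prodMk continuous_const)
  have hcs : HasCompactSupport f := HasCompactSupport.intro hK hf0
  have hd : ∀ x, fderiv ℝ (fun x => charE x ζ) x (Pi.single i 1) =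
      (2 * (Real.pi : ℂ) * Complex.I * ζ i) * charE x ζ := by
    intro x
    rw [(hasFDerivAt_charE x ζ).fderiv]
    simp [Pi.single_apply]
    ring
  have hfd : Continuous fun x => fderiv ℝ f x (Pi.single i 1) :=
    (hf.continuous_fderiv one_ne_zero).clm_apply continuous_const
  have hfs : HasCompactSupport fun x => fderiv ℝ f x (Pi.single i 1) :=
    hcs.fderiv_apply ℝ (Pi.single i 1)
  rw [integral_mul_fderiv_eq_neg_fderiv_mul_of_integrable]
  · simp_rw [hd, mul_assoc, integral_const_mul]
    ring
  · simp_rw [hd]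
    exact ((continuous_const.mul hc).mul hf.continuous).integrable_of_hasCompactSupport
      hcs.mul_left
  · exact (hc.mul hfd).integrable_of_hasCompactSupport hfs.mul_left
  · exact (hc.mul hf.continuous).integrable_of_hasCompactSupport hcs.mul_left
  · exact fun x _ => (hasFDerivAt_charE x ζ).differentiableAt
  · exact fun x _ => (hf.differentiable one_ne_zero) x

/-- Repeated integration by parts in one coordinate: decay of the Fourier integral of a product of
two compactly supported functions, in terms of bounds on their pure derivatives. -/
theorem pow_mul_norm_integral_charE_le {K : Set (Fin N → ℝ)} (hK : IsCompact K) (i : Fin N)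
    (ζ : Fin N → ℝ) {A B : ℕ → (Fin N → ℝ) → ℂ} {C R : ℝ} {M : ℕ} (hC : 0 ≤ C) (hR : 0 ≤ R)
    (hA : ∀ l, ContDiff ℝ 1 (A l)) (hB : ∀ l, ContDiff ℝ 1 (B l))
    (hAd : ∀ l x, fderiv ℝ (A l) x (Pi.single i 1) = A (l + 1) x)
    (hBd : ∀ l x, fderiv ℝ (B l) x (Pi.single i 1) = B (l + 1) x)
    (hA0 : ∀ l x, x ∉ K → A l x = 0)
    (hAb : ∀ l ≤ M, ∀ x, ‖A l x‖ ≤ C * R ^ l) (hBb : ∀ l ≤ M, ∀ x, ‖B l x‖ ≤ C * R ^ l)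
    (m : ℕ) : ∀ p q : ℕ, p + q + m ≤ M →
      |ζ i| ^ m * ‖∫ x, charE x ζ * (A p x * B q x)‖ ≤ volume.real K * C ^ 2 * R ^ (p + q + m) := by
  have hc : Continuous fun x : Fin N → ℝ => charE x ζ :=
    continuous_charE.comp (continuous_id.prodMk continuous_const)
  have hint : ∀ p q, Integrable fun x => charE x ζ * (A p x * B q x) := fun p q =>
    (hc.mul ((hA p).continuous.mul (hB q).continuous)).integrable_of_hasCompactSupport
      (HasCompactSupport.intro hK fun x hx => by simp [hA0 p x hx])
  induction m with
  | zero =>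
    intro p q hpq
    have h0 : ∫ x, charE x ζ * (A p x * B q x) = ∫ x in K, charE x ζ * (A p x * B q x) :=
      (setIntegral_eq_integral_of_forall_compl_eq_zero
        fun x hx => by simp [hA0 p x hx]).symm
    rw [h0, pow_zero, one_mul]
    refine (norm_setIntegral_le_of_norm_le_const (C := C ^ 2 * R ^ (p + q)) hK.measure_lt_top
      fun x _ => ?_).trans (le_of_eq (by rw [add_zero]; ring))
    rw [norm_mul, norm_mul, norm_charE, one_mul]
    calc ‖A p x‖ * ‖B q x‖ ≤ (C * R ^ p) * (C * R ^ q) :=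
          mul_le_mul (hAb p (by omega) x) (hBb q (by omega) x) (norm_nonneg _) (by positivity)
      _ = _ := by ring
  | succ m ih =>
    intro p q hpq
    have hprod : ContDiff ℝ 1 fun x => A p x * B q x := (hA p).mul (hB q)
    have key := integral_charE_mul_fderiv hK i ζ hprod fun x hx => by simp [hA0 p x hx]
    have hd : ∀ x, fderiv ℝ (fun x => A p x * B q x) x (Pi.single i 1) =
        A (p + 1) x * B q x + A p x * B (q + 1) x := by
      intro x
      rw [fderiv_fun_mul ((hA p).differentiable one_ne_zero x)
        ((hB q).differentiable one_ne_zero x)]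
      simp only [add_apply, smul_apply, smul_eq_mul,
        hAd, hBd]
      ring
    simp_rw [hd, mul_add] at key
    rw [integral_add (hint _ _) (hint _ _)] at key
    have hn := congrArg norm key
    rw [norm_mul, norm_neg] at hn
    have hz : ‖2 * (Real.pi : ℂ) * Complex.I * ζ i‖ = 2 * Real.pi * |ζ i| := by
      simp [abs_of_pos Real.pi_pos]
    rw [hz] at hn
    have h1 := ih (p + 1) q (by omega)
    have h2 := ih p (q + 1) (by omega)
    have e1 : p + 1 + q + m = p + q + (m + 1) := by ring
    have e2 : p + (q + 1) + m = p + q + (m + 1) := by ring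
    rw [e1] at h1
    rw [e2] at h2
    set I := ‖∫ x, charE x ζ * (A p x * B q x)‖
    set I1 := ∫ x, charE x ζ * (A (p + 1) x * B q x)
    set I2 := ∫ x, charE x ζ * (A p x * B (q + 1) x)
    have h3 : |ζ i| ^ m * (2 * Real.pi * |ζ i| * I) ≤ |ζ i| ^ m * (‖I1‖ + ‖I2‖) := by
      rw [← hn]
      exact mul_le_mul_of_nonneg_left (norm_add_le _ _) (by positivity)
    have h4 : 0 ≤ |ζ i| ^ m * (|ζ i| * I) := by positivity
    have h5 : |ζ i| ^ (m + 1) * I = |ζ i| ^ m * (|ζ i| * I) := by ring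
    rw [h5]
    nlinarith [Real.pi_gt_three]

end KernelDecay

section AlmostOrthogonality

open scoped ComplexConjugate

variable {N : ℕ}

theorem eLpNorm_two_eq_ofReal_sqrt {α : Type*} [MeasurableSpace α] {μ : MeasureTheory.Measure α}
    {f : α → ℂ} (hf : MemLp f 2 μ) :
    eLpNorm f 2 μ = ENNReal.ofReal (√(∫ x, ‖f x‖ ^ 2 ∂μ)) := by
  rw [hf.eLpNorm_eq_integral_rpow_norm two_ne_zero ENNReal.ofNat_ne_top, Real.sqrt_eq_rpow]
  simp

theorem memLp_invFourierT {g : (Fin N → ℝ) → ℂ} (hg : Integrable g) (hg2 : MemLp g 2) :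
    MemLp (invFourierT g) 2 :=
  ⟨(continuous_invFourierT hg).aestronglyMeasurable, by
    rw [eLpNorm_invFourierT hg hg2]; exact hg2.2⟩

theorem integral_norm_sq_invFourierT {g : (Fin N → ℝ) → ℂ} (hg : Integrable g)
    (hg2 : MemLp g 2) : ∫ x, ‖invFourierT g x‖ ^ 2 = ∫ ξ, ‖g ξ‖ ^ 2 := by
  have h := eLpNorm_invFourierT hg hg2
  rw [eLpNorm_two_eq_ofReal_sqrt hg2, eLpNorm_two_eq_ofReal_sqrt (memLp_invFourierT hg hg2),
    ENNReal.ofReal_eq_ofReal_iff (Real.sqrt_nonneg _) (Real.sqrt_nonneg _)] at h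
  exact (Real.sqrt_inj (integral_nonneg fun _ => by positivity)
    (integral_nonneg fun _ => by positivity)).1 h

theorem charE_sub (x ξ η : Fin N → ℝ) : charE x (η - ξ) = conj (charE x ξ) * charE x η := by
  simp only [charE, ← Complex.exp_conj, ← Complex.exp_add]
  congr 1
  simp only [dotProd, Pi.sub_apply, map_mul, Complex.conj_I, Complex.conj_ofReal, map_ofNat]
  push_cast
  simp only [mul_sub, Finset.sum_sub_distrib]
  ring

/-- Schur test for convolution-dominated kernels. -/
theorem integrable_and_integral_le_of_convolution {g : (Fin N → ℝ) → ℂ} (hg2 : MemLp g 2)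
    {Φ : (Fin N → ℝ) → ℝ} (hΦ : Integrable Φ) (hΦ0 : ∀ z, 0 ≤ Φ z) :
    Integrable (fun p : (Fin N → ℝ) × (Fin N → ℝ) => ‖g p.1‖ * ‖g p.2‖ * Φ (p.1 - p.2)) ∧
    ∫ p : (Fin N → ℝ) × (Fin N → ℝ), ‖g p.1‖ * ‖g p.2‖ * Φ (p.1 - p.2) ≤
      (∫ z, Φ z) * ∫ ξ, ‖g ξ‖ ^ 2 := by
  have hsq : Integrable fun ξ => ‖g ξ‖ ^ 2 := hg2.integrable_norm_pow two_ne_zero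
  have h2 : Integrable fun p : (Fin N → ℝ) × (Fin N → ℝ) => ‖g p.2‖ ^ 2 * Φ (p.1 - p.2) :=
    hsq.convolution_integrand (ContinuousLinearMap.mul ℝ ℝ) hΦ
  have h1 : Integrable fun p : (Fin N → ℝ) × (Fin N → ℝ) => ‖g p.1‖ ^ 2 * Φ (p.1 - p.2) := by
    have := (hsq.convolution_integrand (ContinuousLinearMap.mul ℝ ℝ) hΦ.comp_neg).swap
    refine this.congr (ae_of_all _ fun p => ?_)
    simp
  have hle : ∀ p : (Fin N → ℝ) × (Fin N → ℝ), ‖g p.1‖ * ‖g p.2‖ * Φ (p.1 - p.2) ≤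
      2⁻¹ * (‖g p.1‖ ^ 2 * Φ (p.1 - p.2) + ‖g p.2‖ ^ 2 * Φ (p.1 - p.2)) := by
    intro p
    have := mul_le_mul_of_nonneg_right (two_mul_le_add_sq ‖g p.1‖ ‖g p.2‖) (hΦ0 (p.1 - p.2))
    linarith
  have e2 : ∫ p : (Fin N → ℝ) × (Fin N → ℝ), ‖g p.2‖ ^ 2 * Φ (p.1 - p.2) =
      (∫ z, Φ z) * ∫ ξ, ‖g ξ‖ ^ 2 := by
    rw [Measure.volume_eq_prod, integral_prod_symm _ h2]
    simp_rw [integral_const_mul, integral_sub_right_eq_self, integral_mul_const]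
    ring
  have e1 : ∫ p : (Fin N → ℝ) × (Fin N → ℝ), ‖g p.1‖ ^ 2 * Φ (p.1 - p.2) =
      (∫ z, Φ z) * ∫ ξ, ‖g ξ‖ ^ 2 := by
    rw [Measure.volume_eq_prod, integral_prod _ h1]
    simp_rw [integral_const_mul, integral_sub_left_eq_self, integral_mul_const]
    ring
  have hint := (h1.add h2).const_mul 2⁻¹
  have hm : Integrable (fun p : (Fin N → ℝ) × (Fin N → ℝ) =>
      ‖g p.1‖ * ‖g p.2‖ * Φ (p.1 - p.2)) := by
    refine hint.mono' ?_ (ae_of_all _ fun p => ?_)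
    · have m1 : AEStronglyMeasurable (fun p : (Fin N → ℝ) × (Fin N → ℝ) => ‖g p.1‖) :=
        hg2.1.norm.comp_fst
      have m2 : AEStronglyMeasurable (fun p : (Fin N → ℝ) × (Fin N → ℝ) => ‖g p.2‖) :=
        hg2.1.norm.comp_snd
      have m3 : AEStronglyMeasurable (fun p : (Fin N → ℝ) × (Fin N → ℝ) => Φ (p.1 - p.2)) :=
        hΦ.1.comp_quasiMeasurePreserving (quasiMeasurePreserving_sub volume volume)
      exact (m1.mul m2).mul m3
    · rw [Real.norm_of_nonneg (mul_nonneg (by positivity) (hΦ0 _))]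
      exact hle p
  refine ⟨hm, (integral_mono hm hint hle).trans (le_of_eq ?_)⟩
  rw [integral_const_mul, integral_add' h1 h2, e1, e2]
  ring

/-- Pairing of two operators `g ↦ a · 𝓕⁻¹ g`, written through the kernel in frequency space. -/
theorem integral_conj_mul_invFourierT {K : Set (Fin N → ℝ)} (hK : IsCompact K)
    {a b : (Fin N → ℝ) → ℂ} (ha : Continuous a) (hb : Continuous b) (ha0 : ∀ x, x ∉ K → a x = 0)
    {g h : (Fin N → ℝ) → ℂ} (hg : Integrable g) (hh : Integrable h) :
    ∫ x, conj (a x * invFourierT g x) * (b x * invFourierT h x) =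
      ∫ p : (Fin N → ℝ) × (Fin N → ℝ), conj (g p.1) * h p.2 *
        ∫ x, charE x (p.2 - p.1) * (conj (a x) * b x) := by
  have hgc : Integrable fun ξ => conj (g ξ) := (LinearIsometryEquiv.integrable_comp_iff
    Complex.conjLIE).2 hg
  have hG : Integrable fun p : (Fin N → ℝ) × (Fin N → ℝ) => conj (g p.1) * h p.2 :=
    hgc.mul_prod hh
  have hB : Integrable fun x => conj (a x) * b x :=
    ((Complex.continuous_conj.comp ha).mul hb).integrable_of_hasCompactSupport
      (HasCompactSupport.intro hK fun x hx => by simp [ha0 x hx])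
  have hcont : Continuous fun q : (Fin N → ℝ) × ((Fin N → ℝ) × (Fin N → ℝ)) =>
      charE q.1 (q.2.2 - q.2.1) :=
    continuous_charE.comp (continuous_fst.prodMk (by fun_prop))
  have hI : Integrable (Function.uncurry fun (x : Fin N → ℝ) (p : (Fin N → ℝ) × (Fin N → ℝ)) =>
      conj (g p.1) * h p.2 * (charE x (p.2 - p.1) * (conj (a x) * b x))) := by
    have := (hB.mul_prod hG).bdd_mul (c := 1) hcont.aestronglyMeasurable
      (ae_of_all _ fun q => by simp)
    refine this.congr (ae_of_all _ fun q => ?_)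
    simp only [Function.uncurry]
    ring
  calc ∫ x, conj (a x * invFourierT g x) * (b x * invFourierT h x)
      = ∫ x, ∫ p : (Fin N → ℝ) × (Fin N → ℝ),
          conj (g p.1) * h p.2 * (charE x (p.2 - p.1) * (conj (a x) * b x)) := by
        congr 1
        funext x
        have e1 : conj (invFourierT g x) = ∫ ξ, conj (charE x ξ) * conj (g ξ) := by
          unfold invFourierT
          rw [← integral_conj]
          simp only [map_mul]
          rfl
        have e2 : invFourierT h x = ∫ ξ, charE x ξ * h ξ := rfl
        rw [map_mul, e1, e2]
        calc _ = (conj (a x) * b x) * ((∫ ξ, conj (charE x ξ) * conj (g ξ)) *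
              ∫ ξ, charE x ξ * h ξ) := by ring
          _ = _ := by
            rw [← integral_prod_mul, ← integral_const_mul]
            congr 1
            funext p
            rw [charE_sub]
            ring
    _ = ∫ p : (Fin N → ℝ) × (Fin N → ℝ), ∫ x,
          conj (g p.1) * h p.2 * (charE x (p.2 - p.1) * (conj (a x) * b x)) :=
        integral_integral_swap hI
    _ = _ := by simp_rw [integral_const_mul]

/-- Almost orthogonality: if `a ν · 𝓕⁻¹ (1_{Q ν} ·)` are pairwise almost orthogonal with a
convolution-dominated kernel, then their finite sums are uniformly bounded on `L²`. -/
theorem integral_norm_sq_sum_le {ι : Type*} (F : Finset ι) {Q : ι → Set (Fin N → ℝ)}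
    (hQm : ∀ ν, MeasurableSet (Q ν)) (hQd : Pairwise fun ν μ => Disjoint (Q ν) (Q μ))
    {K : Set (Fin N → ℝ)} (hK : IsCompact K) {a : ι → (Fin N → ℝ) → ℂ}
    (ha : ∀ ν, Continuous (a ν)) (ha0 : ∀ ν x, x ∉ K → a ν x = 0)
    {A : ℝ} (hA : ∀ ν x, ‖a ν x‖ ≤ A)
    {Φ : (Fin N → ℝ) → ℝ} (hΦ : Integrable Φ) (hΦ0 : ∀ z, 0 ≤ Φ z)
    (hk : ∀ ν ∈ F, ∀ μ ∈ F, ν ≠ μ → ∀ ξ ∈ Q ν, ∀ η ∈ Q μ,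
      ‖∫ x, charE x (η - ξ) * (conj (a ν x) * a μ x)‖ ≤ Φ (ξ - η))
    {g : (Fin N → ℝ) → ℂ} (hg : Integrable g) (hg2 : MemLp g 2) :
    ∫ x, ‖∑ ν ∈ F, a ν x * invFourierT ((Q ν).indicator g) x‖ ^ 2 ≤
      (A ^ 2 + ∫ z, Φ z) * ∫ ξ, ‖g ξ‖ ^ 2 := by
  classical
  have hgi : ∀ ν, Integrable ((Q ν).indicator g) := fun ν => hg.indicator (hQm ν)
  have hgi2 : ∀ ν, MemLp ((Q ν).indicator g) 2 := fun ν => hg2.indicator (hQm ν)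
  have hsq : Integrable fun ξ => ‖g ξ‖ ^ 2 := hg2.integrable_norm_pow two_ne_zero
  obtain ⟨hGint, hGle⟩ := integrable_and_integral_le_of_convolution hg2 hΦ hΦ0
  set G : (Fin N → ℝ) × (Fin N → ℝ) → ℝ := fun p => ‖g p.1‖ * ‖g p.2‖ * Φ (p.1 - p.2) with hG
  have hG0 : ∀ p, 0 ≤ G p := fun p => mul_nonneg (by positivity) (hΦ0 _)
  set u : ι → (Fin N → ℝ) → ℂ := fun ν x => a ν x * invFourierT ((Q ν).indicator g) x with hu
  have huc : ∀ ν, Continuous (u ν) := fun ν => (ha ν).mul (continuous_invFourierT (hgi ν))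
  have hu0 : ∀ ν x, x ∉ K → u ν x = 0 := fun ν x hx => by simp [hu, ha0 ν x hx]
  set I : ι → ι → ℂ := fun ν μ => ∫ x, conj (u ν x) * u μ x with hI
  have hint : ∀ ν μ, Integrable fun x => conj (u ν x) * u μ x := fun ν μ =>
    ((Complex.continuous_conj.comp (huc ν)).mul (huc μ)).integrable_of_hasCompactSupport
      (HasCompactSupport.intro hK fun x hx => by simp [hu0 ν x hx])
  have hexp : ((∫ x, ‖∑ ν ∈ F, u ν x‖ ^ 2 : ℝ) : ℂ) = ∑ ν ∈ F, ∑ μ ∈ F, I ν μ := by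
    rw [← integral_complex_ofReal]
    simp only [hI]
    simp_rw [← integral_finsetSum F fun μ _ => hint _ μ]
    rw [← integral_finsetSum F fun ν _ => integrable_finsetSum F fun μ _ => hint ν μ]
    congr 1
    funext x
    rw [Complex.ofReal_pow, ← Complex.conj_mul', map_sum, Finset.sum_mul_sum]
  have hdiag : ∀ ν, ‖I ν ν‖ ≤ A ^ 2 * ∫ ξ in Q ν, ‖g ξ‖ ^ 2 := by
    intro ν
    have e1 : I ν ν = ((∫ x, ‖u ν x‖ ^ 2 : ℝ) : ℂ) := by
      rw [← integral_complex_ofReal]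
      simp only [hI]
      congr 1
      funext x
      rw [Complex.conj_mul', Complex.ofReal_pow]
    have e2 : ∫ ξ in Q ν, ‖g ξ‖ ^ 2 = ∫ x, ‖invFourierT ((Q ν).indicator g) x‖ ^ 2 := by
      rw [integral_norm_sq_invFourierT (hgi ν) (hgi2 ν), ← integral_indicator (hQm ν)]
      congr 1
      funext ξ
      by_cases hξ : ξ ∈ Q ν <;> simp [hξ]
    rw [e1, Complex.norm_real, Real.norm_of_nonneg (integral_nonneg fun _ => by positivity), e2,
      ← integral_const_mul]
    refine integral_mono_of_nonneg (ae_of_all _ fun _ => by positivity)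
      (((memLp_invFourierT (hgi ν) (hgi2 ν)).integrable_norm_pow two_ne_zero).const_mul _)
      (ae_of_all _ fun x => ?_)
    simp only [hu, norm_mul, mul_pow]
    exact mul_le_mul_of_nonneg_right (pow_le_pow_left₀ (norm_nonneg _) (hA ν x) 2) (by positivity)
  have hoff : ∀ ν ∈ F, ∀ μ ∈ F, ν ≠ μ → ‖I ν μ‖ ≤ ∫ p in Q ν ×ˢ Q μ, G p := by
    intro ν hν μ hμ hne
    simp only [hI, hu]
    rw [integral_conj_mul_invFourierT hK (ha ν) (ha μ) (ha0 ν) (hgi ν) (hgi μ),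
      ← integral_indicator ((hQm ν).prod (hQm μ))]
    refine norm_integral_le_of_norm_le (hGint.indicator ((hQm ν).prod (hQm μ)))
      (ae_of_all _ fun p => ?_)
    by_cases h1 : p.1 ∈ Q ν
    · by_cases h2 : p.2 ∈ Q μ
      · have hm : p ∈ Q ν ×ˢ Q μ := ⟨h1, h2⟩
        simp only [Set.indicator_of_mem h1, Set.indicator_of_mem h2, Set.indicator_of_mem hm,
          norm_mul, RCLike.norm_conj, hG]
        exact mul_le_mul_of_nonneg_left (hk ν hν μ hμ hne _ h1 _ h2) (by positivity)
      · simp only [Set.indicator_of_notMem h2, mul_zero, zero_mul, norm_zero]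
        exact Set.indicator_nonneg (fun p _ => hG0 p) p
    · simp only [Set.indicator_of_notMem h1, map_zero, zero_mul, norm_zero]
      exact Set.indicator_nonneg (fun p _ => hG0 p) p
  have hset : ∀ ν μ, 0 ≤ ∫ p in Q ν ×ˢ Q μ, G p := fun ν μ => integral_nonneg fun p => hG0 p
  have hset' : ∀ ν, 0 ≤ A ^ 2 * ∫ ξ in Q ν, ‖g ξ‖ ^ 2 := fun ν =>
    mul_nonneg (by positivity) (integral_nonneg fun _ => by positivity)
  have hall : ∀ ν ∈ F, ∀ μ ∈ F, ‖I ν μ‖ ≤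
      (if ν = μ then A ^ 2 * ∫ ξ in Q ν, ‖g ξ‖ ^ 2 else 0) + ∫ p in Q ν ×ˢ Q μ, G p := by
    intro ν hν μ hμ
    by_cases h : ν = μ
    · subst h
      rw [if_pos rfl]
      linarith [hdiag ν, hset ν ν]
    · rw [if_neg h, zero_add]
      exact hoff ν hν μ hμ h
  have hsum1 : ∑ ν ∈ F, ∫ ξ in Q ν, ‖g ξ‖ ^ 2 ≤ ∫ ξ, ‖g ξ‖ ^ 2 := by
    rw [← integral_biUnion_finset F (fun ν _ => hQm ν) (fun ν _ μ _ h => hQd h)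
      fun ν _ => hsq.integrableOn]
    exact setIntegral_le_integral hsq (ae_of_all _ fun _ => by positivity)
  have hsum2 : ∑ ν ∈ F, ∑ μ ∈ F, ∫ p in Q ν ×ˢ Q μ, G p ≤ ∫ p, G p := by
    rw [← Finset.sum_product' (f := fun ν μ => ∫ p in Q ν ×ˢ Q μ, G p),
      ← integral_biUnion_finset (F ×ˢ F) (s := fun q : ι × ι => Q q.1 ×ˢ Q q.2)
        (fun q _ => (hQm q.1).prod (hQm q.2)) ?_ fun q _ => hGint.integrableOn]
    · exact setIntegral_le_integral hGint (ae_of_all _ hG0)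
    · intro q _ r _ hqr
      simp only [Function.onFun]
      rw [Set.disjoint_prod]
      by_cases h : q.1 = r.1
      · exact Or.inr (hQd fun h' => hqr (Prod.ext h h'))
      · exact Or.inl (hQd h)
  have hnorm : ∫ x, ‖∑ ν ∈ F, u ν x‖ ^ 2 = ‖∑ ν ∈ F, ∑ μ ∈ F, I ν μ‖ := by
    rw [← hexp, Complex.norm_real, Real.norm_of_nonneg (integral_nonneg fun _ => by positivity)]
  calc ∫ x, ‖∑ ν ∈ F, u ν x‖ ^ 2 = ‖∑ ν ∈ F, ∑ μ ∈ F, I ν μ‖ := hnorm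
    _ ≤ ∑ ν ∈ F, ∑ μ ∈ F, ‖I ν μ‖ :=
      (norm_sum_le _ _).trans (Finset.sum_le_sum fun ν _ => norm_sum_le _ _)
    _ ≤ ∑ ν ∈ F, ∑ μ ∈ F, ((if ν = μ then A ^ 2 * ∫ ξ in Q ν, ‖g ξ‖ ^ 2 else 0) +
        ∫ p in Q ν ×ˢ Q μ, G p) :=
      Finset.sum_le_sum fun ν hν => Finset.sum_le_sum fun μ hμ => hall ν hν μ hμ
    _ = A ^ 2 * (∑ ν ∈ F, ∫ ξ in Q ν, ‖g ξ‖ ^ 2) +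
        ∑ ν ∈ F, ∑ μ ∈ F, ∫ p in Q ν ×ˢ Q μ, G p := by
      simp only [Finset.sum_add_distrib, Finset.mul_sum]
      congr 1
      refine Finset.sum_congr rfl fun ν hν => ?_
      rw [Finset.sum_ite_eq, if_pos hν]
    _ ≤ A ^ 2 * (∫ ξ, ‖g ξ‖ ^ 2) + (∫ z, Φ z) * ∫ ξ, ‖g ξ‖ ^ 2 :=
      add_le_add (mul_le_mul_of_nonneg_left hsum1 (by positivity)) (hsum2.trans hGle)
    _ = _ := by ring

end AlmostOrthogonality

section Cells

variable {N : ℕ}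

/-- A decomposition of frequency space into countably many cells, the cell of `ξ` having diameter
at most `(1 + ‖ξ‖)^t / 4`, with a colouring by finitely many colours such that distinct cells
of the same colour are separated at the same scale. -/
theorem exists_cells (N : ℕ) {t : ℝ} (ht0 : 0 ≤ t) (ht1 : t ≤ 1) :
    ∃ (κ : (Fin N → ℝ) → ℕ × (Fin N → ℤ)) (χ : ℕ × (Fin N → ℤ) → Bool × (Fin N → Bool)),
      Measurable κ ∧
      (∀ ξ η, κ ξ = κ η → ‖ξ - η‖ ≤ (1 + ‖ξ‖) ^ t / 4) ∧
      (∀ ξ η, κ ξ ≠ κ η → χ (κ ξ) = χ (κ η) → (1 + ‖ξ‖) ^ t ≤ 8 * ‖ξ - η‖) := by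
  set j : (Fin N → ℝ) → ℕ := fun ξ => Nat.log 2 ⌊1 + ‖ξ‖⌋₊ with hj
  set s : ℕ → ℝ := fun n => ((2 : ℝ) ^ n) ^ t / 4 with hs
  have hspos : ∀ n, 0 < s n := fun n => by simp only [hs]; positivity
  have hfl : ∀ ξ : Fin N → ℝ, ⌊1 + ‖ξ‖⌋₊ ≠ 0 := fun ξ => by
    have : 1 ≤ ⌊1 + ‖ξ‖⌋₊ := Nat.le_floor (by push_cast; linarith [norm_nonneg ξ])
    omega
  have hjl : ∀ ξ, (2 : ℝ) ^ j ξ ≤ 1 + ‖ξ‖ := fun ξ => by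
    have h1 : 2 ^ j ξ ≤ ⌊1 + ‖ξ‖⌋₊ := Nat.pow_log_le_self 2 (hfl ξ)
    have h2 : ((2 ^ j ξ : ℕ) : ℝ) ≤ 1 + ‖ξ‖ :=
      (Nat.cast_le.2 h1).trans (Nat.floor_le (by positivity))
    simpa using h2
  have hju : ∀ ξ, 1 + ‖ξ‖ < (2 : ℝ) ^ (j ξ + 1) := fun ξ => by
    have h1 : ⌊1 + ‖ξ‖⌋₊ < 2 ^ (j ξ + 1) := Nat.lt_pow_succ_log_self one_lt_two _
    have h2 := (Nat.floor_lt (by positivity)).1 h1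
    simpa using h2
  have hWs : ∀ ξ, (1 + ‖ξ‖) ^ t ≤ 8 * s (j ξ) := fun ξ => by
    have h1 : (1 + ‖ξ‖) ^ t ≤ (2 * 2 ^ j ξ : ℝ) ^ t :=
      Real.rpow_le_rpow (by positivity) (by rw [← pow_succ']; exact (hju ξ).le) ht0
    rw [Real.mul_rpow (by positivity) (by positivity)] at h1
    have h2 : (2 : ℝ) ^ t ≤ 2 := by
      simpa using Real.rpow_le_rpow_of_exponent_le one_le_two ht1
    have h3 : 0 ≤ ((2 : ℝ) ^ j ξ) ^ t := by positivity
    simp only [hs]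
    nlinarith
  have hWself : ∀ ξ : Fin N → ℝ, (1 + ‖ξ‖) ^ t ≤ 1 + ‖ξ‖ := fun ξ => by
    simpa using Real.rpow_le_rpow_of_exponent_le
      (by linarith [norm_nonneg ξ] : 1 ≤ 1 + ‖ξ‖) ht1
  have hjfar : ∀ ξ η, j ξ + 2 ≤ j η → (1 + ‖ξ‖) * 2 ≤ 1 + ‖η‖ := fun ξ η h => by
    have h1 : (2 : ℝ) ^ (j ξ + 2) ≤ 2 ^ j η := pow_le_pow_right₀ one_le_two h
    have h2 := hju ξ
    have h3 := hjl η
    rw [pow_succ] at h1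
    linarith
  refine ⟨fun ξ => (j ξ, fun i => ⌊ξ i / s (j ξ)⌋),
    fun c => (decide (c.1 % 2 = 0), fun i => decide (c.2 i % 2 = 0)), ?_, ?_, ?_⟩
  · have hjm : Measurable j := by
      have h1 : Measurable fun ξ : Fin N → ℝ => ⌊1 + ‖ξ‖⌋₊ :=
        Nat.measurable_floor.comp (measurable_const.add measurable_norm)
      exact (measurable_from_top (f := Nat.log 2)).comp h1
    have hsm : Measurable fun ξ => s (j ξ) := (measurable_from_top (f := s)).comp hjm
    refine hjm.prodMk (measurable_pi_lambda _ fun i => ?_)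
    exact Int.measurable_floor.comp ((measurable_pi_apply i).div hsm)
  · intro ξ η h
    simp only [Prod.mk.injEq] at h
    obtain ⟨h1, h2⟩ := h
    have hle : s (j ξ) ≤ (1 + ‖ξ‖) ^ t / 4 := by
      simp only [hs]
      have := Real.rpow_le_rpow (by positivity) (hjl ξ) ht0
      linarith
    refine le_trans ((pi_norm_le_iff_of_nonneg (hspos (j ξ)).le).2 fun i => ?_) hle
    have h3 := congrFun h2 i
    simp only [← h1] at h3
    have h4 := (Int.abs_sub_lt_one_of_floor_eq_floor h3).le
    rw [← sub_div, abs_div, abs_of_pos (hspos _), div_le_one (hspos _)] at h4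
    simpa using h4
  · intro ξ η hne hχ
    simp only [Prod.mk.injEq, decide_eq_decide] at hχ
    obtain ⟨hp, hk⟩ := hχ
    have hd1 : ‖η‖ ≤ ‖ξ‖ + ‖ξ - η‖ := norm_le_norm_add_norm_sub ξ η
    have hd2 : ‖ξ‖ ≤ ‖η‖ + ‖ξ - η‖ := norm_le_norm_add_norm_sub' ξ η
    rcases lt_trichotomy (j ξ) (j η) with hlt | heq | hgt
    · have := hjfar ξ η (by omega)
      linarith [hWself ξ, norm_nonneg ξ, norm_nonneg (ξ - η)]
    · have hex : ∃ i, ⌊ξ i / s (j ξ)⌋ ≠ ⌊η i / s (j ξ)⌋ := by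
        by_contra! hcon
        refine hne (Prod.ext heq (funext fun i => ?_))
        simp only
        rw [hcon i, heq]
      obtain ⟨i, hi⟩ := hex
      have hki := congrFun hk i
      simp only [← heq, decide_eq_decide] at hki
      have hpos := hspos (j ξ)
      have key : s (j ξ) ≤ |ξ i - η i| := by
        have hgap : 1 ≤ |ξ i / s (j ξ) - η i / s (j ξ)| := by
          have a1 := Int.floor_le (ξ i / s (j ξ))
          have a2 := Int.lt_floor_add_one (ξ i / s (j ξ))
          have b1 := Int.floor_le (η i / s (j ξ))
          have b2 := Int.lt_floor_add_one (η i / s (j ξ))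
          rcases lt_or_gt_of_ne hi with hl | hl
          · have h2 : ⌊ξ i / s (j ξ)⌋ + 2 ≤ ⌊η i / s (j ξ)⌋ := by omega
            have h3 : ((⌊ξ i / s (j ξ)⌋ : ℝ)) + 2 ≤ ⌊η i / s (j ξ)⌋ := by exact_mod_cast h2
            rw [abs_sub_comm]
            exact le_trans (by linarith) (le_abs_self _)
          · have h2 : ⌊η i / s (j ξ)⌋ + 2 ≤ ⌊ξ i / s (j ξ)⌋ := by omega
            have h3 : ((⌊η i / s (j ξ)⌋ : ℝ)) + 2 ≤ ⌊ξ i / s (j ξ)⌋ := by exact_mod_cast h2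
            exact le_trans (by linarith) (le_abs_self _)
        rw [← sub_div, abs_div, abs_of_pos hpos, le_div_iff₀ hpos, one_mul] at hgap
        exact hgap
      have hn : |ξ i - η i| ≤ ‖ξ - η‖ := by simpa using norm_le_pi_norm (ξ - η) i
      linarith [hWs ξ]
    · have := hjfar η ξ (by omega)
      linarith [hWself ξ, norm_nonneg ξ, norm_nonneg η, norm_nonneg (ξ - η)]

end Cells

section Taylor

/-- Taylor's inequality for a chain of successive derivatives on `[0, 1]`. -/
theorem norm_sub_taylor_le_of_chain (M : ℕ) : ∀ (φ : ℕ → ℝ → ℂ) {C : ℝ},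
    (∀ k t, HasDerivAt (φ k) (φ (k + 1) t) t) →
    (∀ t ∈ Set.Icc (0 : ℝ) 1, ‖φ M t‖ ≤ C) →
    ∀ t ∈ Set.Icc (0 : ℝ) 1,
      ‖φ 0 t - ∑ k ∈ Finset.range M, (t ^ k / (k.factorial : ℝ) : ℝ) • φ k 0‖ ≤ C := by
  induction M with
  | zero => intro φ C _ hC t ht; simpa using hC t ht
  | succ M ih =>
    intro φ C hφ hC t ht
    set ψ : ℝ → ℂ := fun t =>
      φ 0 t - ∑ k ∈ Finset.range (M + 1), (t ^ k / (k.factorial : ℝ) : ℝ) • φ k 0 with hψ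
    have hψd : ∀ t, HasDerivAt ψ (φ 1 t -
        ∑ k ∈ Finset.range M, (t ^ k / (k.factorial : ℝ) : ℝ) • φ (k + 1) 0) t := by
      intro t
      refine (hφ 0 t).sub ?_
      simp_rw [Finset.sum_range_succ' _ M]
      have hs : HasDerivAt (fun t : ℝ => ∑ k ∈ Finset.range M,
          (t ^ (k + 1) / ((k + 1).factorial : ℝ) : ℝ) • φ (k + 1) 0)
          (∑ k ∈ Finset.range M, (t ^ k / (k.factorial : ℝ) : ℝ) • φ (k + 1) 0) t := by
        refine HasDerivAt.fun_sum fun k _ => HasDerivAt.smul_const ?_ _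
        refine ((hasDerivAt_pow (k + 1) t).div_const _).congr_deriv ?_
        have : (k.factorial : ℝ) ≠ 0 := by positivity
        rw [Nat.factorial_succ]
        push_cast
        field_simp
      simpa using hs.add_const ((t ^ 0 / ((0 : ℕ).factorial : ℝ) : ℝ) • φ 0 0)
    have hb := ih (fun k => φ (k + 1)) (fun k => hφ (k + 1)) hC
    have hC0 : 0 ≤ C := (norm_nonneg _).trans (hC 0 (by simp))
    have hmv := Convex.norm_image_sub_le_of_norm_hasDerivWithin_le (f := ψ) (C := C)
      (fun x hx => (hψd x).hasDerivWithinAt) (fun x hx => hb x hx) (convex_Icc (0 : ℝ) 1)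
      (show (0 : ℝ) ∈ Set.Icc (0 : ℝ) 1 by simp) ht
    have h0 : ψ 0 = 0 := by
      simp only [hψ]
      rw [Finset.sum_range_succ']
      simp
    rw [h0, sub_zero, sub_zero] at hmv
    refine hmv.trans ?_
    rw [Real.norm_of_nonneg ht.1]
    exact mul_le_of_le_one_right hC0 ht.2

end Taylor

section Taylor

variable {n N : ℕ} {a : (Fin n → ℝ) → (Fin N → ℝ) → ℂ}

theorem hasDerivAt_symbol_line
    (ha : ContDiff ℝ ∞ fun p : (Fin n → ℝ) × (Fin N → ℝ) => a p.1 p.2)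
    (x : Fin n → ℝ) (c v : Fin N → ℝ) (t : ℝ) :
    HasDerivAt (fun t : ℝ => a x (c + t • v)) (∑ i, (v i : ℂ) * pdTheta i a x (c + t • v)) t := by
  have hd : Differentiable ℝ (a x) :=
    (ha.comp (contDiff_const.prodMk contDiff_id)).differentiable (by simp)
  have hl : HasDerivAt (fun t : ℝ => c + t • v) v t := by
    simpa using ((hasDerivAt_id t).smul_const v).const_add c
  have h := (hd (c + t • v)).hasFDerivAt.comp_hasDerivAt t hl
  refine h.congr_deriv ?_
  conv_lhs => rw [pi_eq_sum_univ' v]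
  rw [map_sum]
  refine Finset.sum_congr rfl fun i _ => ?_
  rw [map_smul, Complex.real_smul]
  unfold pdTheta
  congr 3
  ext j
  simp [Pi.single_apply]

/-- The `k`-th derivative of `t ↦ a(x, c + t v)`. -/
noncomputable def lineDerivSum (a : (Fin n → ℝ) → (Fin N → ℝ) → ℂ) (x : Fin n → ℝ)
    (c v : Fin N → ℝ) (k : ℕ) (t : ℝ) : ℂ :=
  ∑ L : Fin k → Fin N, ((∏ i, v (L i) : ℝ) : ℂ) * symbolDeriv [] (List.ofFn L) a x (c + t • v)

theorem hasDerivAt_lineDerivSum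
    (ha : ContDiff ℝ ∞ fun p : (Fin n → ℝ) × (Fin N → ℝ) => a p.1 p.2)
    (x : Fin n → ℝ) (c v : Fin N → ℝ) (k : ℕ) (t : ℝ) :
    HasDerivAt (lineDerivSum a x c v k) (lineDerivSum a x c v (k + 1) t) t := by
  unfold lineDerivSum
  have h : HasDerivAt (fun t : ℝ => ∑ L : Fin k → Fin N,
      ((∏ i, v (L i) : ℝ) : ℂ) * symbolDeriv [] (List.ofFn L) a x (c + t • v))
      (∑ L : Fin k → Fin N, ((∏ i, v (L i) : ℝ) : ℂ) *
        ∑ i, (v i : ℂ) * pdTheta i (symbolDeriv [] (List.ofFn L) a) x (c + t • v)) t :=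
    HasDerivAt.fun_sum fun L _ => (hasDerivAt_symbol_line
      (contDiff_symbolDeriv [] (List.ofFn L) ha) x c v t).const_mul _
  refine h.congr_deriv ?_
  rw [← (Fin.consEquiv fun _ => Fin N).sum_comp, Fintype.sum_prod_type, Finset.sum_comm]
  refine Finset.sum_congr rfl fun L _ => ?_
  rw [Finset.mul_sum]
  refine Finset.sum_congr rfl fun i _ => ?_
  simp only [Fin.consEquiv, Equiv.coe_fn_mk, Fin.prod_univ_succ, Fin.cons_zero, Fin.cons_succ,
    List.ofFn_succ]
  simp only [symbolDeriv, List.foldr_cons, List.foldr_nil]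
  push_cast
  ring

/-- Taylor's formula with remainder for a symbol in the frequency variable. -/
theorem norm_symbol_sub_taylor_le
    (ha : ContDiff ℝ ∞ fun p : (Fin n → ℝ) × (Fin N → ℝ) => a p.1 p.2)
    (x : Fin n → ℝ) (c ξ : Fin N → ℝ) (M : ℕ) {B : ℝ}
    (hB : ∀ L : Fin M → Fin N, ∀ t ∈ Set.Icc (0 : ℝ) 1,
      ‖symbolDeriv [] (List.ofFn L) a x (c + t • (ξ - c))‖ ≤ B) :
    ‖a x ξ - ∑ k ∈ Finset.range M, ∑ L : Fin k → Fin N,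
      (((k.factorial : ℝ)⁻¹ * ∏ i, (ξ - c) (L i) : ℝ) : ℂ) * symbolDeriv [] (List.ofFn L) a x c‖ ≤
      (N : ℝ) ^ M * ‖ξ - c‖ ^ M * B := by
  have hC : ∀ t ∈ Set.Icc (0 : ℝ) 1, ‖lineDerivSum a x c (ξ - c) M t‖ ≤
      (N : ℝ) ^ M * ‖ξ - c‖ ^ M * B := by
    intro t ht
    unfold lineDerivSum
    refine (norm_sum_le _ _).trans ?_
    calc _ ≤ ∑ _L : Fin M → Fin N, ‖ξ - c‖ ^ M * B := by
          refine Finset.sum_le_sum fun L _ => ?_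
          rw [norm_mul, Complex.norm_real, norm_prod]
          refine mul_le_mul ?_ (hB L t ht) (norm_nonneg _) (by positivity)
          calc ∏ i, ‖(ξ - c) (L i)‖ ≤ ∏ _i : Fin M, ‖ξ - c‖ :=
                Finset.prod_le_prod (fun _ _ => norm_nonneg _) fun i _ => norm_le_pi_norm _ _
            _ = _ := by simp
      _ = _ := by simp [mul_assoc]
  have h := norm_sub_taylor_le_of_chain M (lineDerivSum a x c (ξ - c))
    (hasDerivAt_lineDerivSum ha x c (ξ - c)) hC 1 (by simp)
  convert h using 3
  · simp [lineDerivSum, symbolDeriv]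
  · refine Finset.sum_congr rfl fun k _ => ?_
    simp only [lineDerivSum, zero_smul, add_zero, one_pow, Complex.real_smul, Finset.mul_sum]
    refine Finset.sum_congr rfl fun L _ => ?_
    push_cast
    ring

end Taylor

section Weight

theorem jweight_le_rpow {N : ℕ} (s : ℝ) (θ : Fin N → ℝ) :
    jweight s θ ≤ 2 ^ |s| * (1 + ‖θ‖) ^ s := by
  have hn := norm_nonneg θ
  have h1 : 1 + ‖θ‖ ^ 2 ≤ (1 + ‖θ‖) ^ 2 := by nlinarith
  have h2 : (1 + ‖θ‖) ^ 2 ≤ 2 * (1 + ‖θ‖ ^ 2) := by nlinarith [sq_nonneg (1 - ‖θ‖)]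
  have hW : ((1 + ‖θ‖) ^ 2) ^ (s / 2) = (1 + ‖θ‖) ^ s := by
    rw [← Real.rpow_natCast, ← Real.rpow_mul (by positivity)]
    congr 1
    push_cast
    ring
  unfold jweight
  rcases le_total 0 s with hs | hs
  · calc (1 + ‖θ‖ ^ 2) ^ (s / 2) ≤ ((1 + ‖θ‖) ^ 2) ^ (s / 2) :=
          Real.rpow_le_rpow (by positivity) h1 (by positivity)
      _ = 1 * (1 + ‖θ‖) ^ s := by rw [hW, one_mul]
      _ ≤ _ := by
          gcongr
          exact Real.one_le_rpow (by norm_num) (abs_nonneg s)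
  · have h3 : (1 + ‖θ‖) ^ 2 / 2 ≤ 1 + ‖θ‖ ^ 2 := by linarith
    calc (1 + ‖θ‖ ^ 2) ^ (s / 2) ≤ ((1 + ‖θ‖) ^ 2 / 2) ^ (s / 2) :=
          Real.rpow_le_rpow_of_nonpos (by positivity) h3 (by linarith)
      _ = 2 ^ (-(s / 2)) * (1 + ‖θ‖) ^ s := by
          rw [Real.div_rpow (by positivity) (by norm_num), hW, Real.rpow_neg (by norm_num)]
          field_simp
      _ ≤ _ := by
          gcongr
          · norm_num
          · rw [abs_of_nonpos hs]; linarith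

end Weight

section Frozen

open scoped ComplexConjugate

variable {N : ℕ}

theorem exists_abs_apply_eq_norm {ζ : Fin N → ℝ} (hζ : 0 < ‖ζ‖) : ∃ i, |ζ i| = ‖ζ‖ := by
  by_contra! h
  exact lt_irrefl ‖ζ‖ ((pi_norm_lt_iff hζ).2 fun i => (norm_le_pi_norm ζ i).lt_of_ne (h i))

/-- Off-diagonal decay of the kernels of the frozen operators. -/
theorem exists_norm_integral_charE_le_rpow {t δ : ℝ} (hδ0 : 0 ≤ δ) (hδt : δ < t)
    {ι : Type*} (c : ι → Fin N → ℝ) {K : Set (Fin N → ℝ)} (hK : IsCompact K)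
    {a : ι → (Fin N → ℝ) → ℂ} {D : Fin N → ℕ → ι → (Fin N → ℝ) → ℂ}
    (hD0 : ∀ i ν, D i 0 ν = a ν) (hDc : ∀ i l ν, ContDiff ℝ 1 (D i l ν))
    (hDd : ∀ i l ν x, fderiv ℝ (D i l ν) x (Pi.single i 1) = D i (l + 1) ν x)
    (hDz : ∀ i l ν x, x ∉ K → D i l ν x = 0)
    (hDb : ∀ M : ℕ, ∃ C : ℝ, 0 ≤ C ∧ ∀ i, ∀ l ≤ M, ∀ ν x,
      ‖D i l ν x‖ ≤ C * ((1 + ‖c ν‖) ^ δ) ^ l) :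
    ∃ C : ℝ, 0 ≤ C ∧ ∀ ν μ ξ η, 1 + ‖c ν‖ ≤ 2 * (1 + ‖ξ‖) → 1 + ‖c μ‖ ≤ 2 * (1 + ‖η‖) →
      (1 + ‖ξ‖) ^ t ≤ 8 * ‖ξ - η‖ → (1 + ‖η‖) ^ t ≤ 8 * ‖ξ - η‖ →
      ‖∫ x, charE x (η - ξ) * (conj (a ν x) * a μ x)‖ ≤
        C * (1 + ‖ξ - η‖) ^ (-(N + 1 : ℝ)) := by
  have ht : 0 < t := hδ0.trans_lt hδt
  set s : ℝ := δ / t with hs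
  have hs0 : 0 ≤ s := by positivity
  have hs1 : s < 1 := (div_lt_one ht).2 hδt
  obtain ⟨M, hM⟩ := exists_nat_ge ((N + 1 : ℝ) / (1 - s))
  rw [div_le_iff₀ (by linarith)] at hM
  obtain ⟨C, hC, hCb⟩ := hDb M
  set B : ℝ := 2 ^ δ * 8 ^ s with hB
  have hB0 : 0 ≤ B := by positivity
  refine ⟨volume.real K * C ^ 2 * B ^ M * 9 ^ (M * (1 - s)), by positivity, ?_⟩
  intro ν μ ξ η hν hμ hξ hη
  set d : ℝ := ‖ξ - η‖ with hd
  have hd8 : 1 ≤ 8 * d :=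
    (Real.one_le_rpow (by linarith [norm_nonneg ξ]) ht.le).trans hξ
  have hd0 : 0 < d := by linarith
  have hdn : ‖η - ξ‖ = d := by rw [hd, norm_sub_rev]
  obtain ⟨i, hi⟩ := exists_abs_apply_eq_norm (ζ := η - ξ) (by rw [hdn]; exact hd0)
  have hR : ∀ (θ : Fin N → ℝ) ν, 1 + ‖c ν‖ ≤ 2 * (1 + ‖θ‖) → (1 + ‖θ‖) ^ t ≤ 8 * d →
      (1 + ‖c ν‖) ^ δ ≤ B * d ^ s := by
    intro θ ν h1 h2
    have h0 : 0 ≤ 1 + ‖θ‖ := by positivity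
    calc (1 + ‖c ν‖) ^ δ ≤ (2 * (1 + ‖θ‖)) ^ δ := Real.rpow_le_rpow (by positivity) h1 hδ0
      _ = 2 ^ δ * ((1 + ‖θ‖) ^ t) ^ s := by
          rw [Real.mul_rpow (by norm_num) h0, ← Real.rpow_mul h0, hs, mul_div_cancel₀ _ ht.ne']
      _ ≤ 2 ^ δ * (8 * d) ^ s := by gcongr
      _ = B * d ^ s := by rw [Real.mul_rpow (by norm_num) hd0.le, hB, mul_assoc]
  have hkey := pow_mul_norm_integral_charE_le (M := M) hK i (η - ξ)
    (A := fun l x => conj (D i l ν x)) (B := fun l x => D i l μ x) (C := C) (R := B * d ^ s) hC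
    (by positivity) (fun l => Complex.conjCLE.contDiff.comp (hDc i l ν)) (fun l => hDc i l μ)
    (fun l x => ?_) (fun l x => hDd i l μ x) (fun l x hx => by simp [hDz i l ν x hx])
    (fun l hl x => ?_) (fun l hl x => ?_) M 0 0 (by omega)
  · simp only [hD0, hi, hdn, zero_add] at hkey
    rw [← le_div_iff₀' (by positivity)] at hkey
    refine hkey.trans ?_
    have h1 : (d ^ s) ^ M / d ^ M = d ^ (-(M * (1 - s))) := by
      rw [← Real.rpow_natCast, ← Real.rpow_natCast, ← Real.rpow_mul hd0.le,
        ← Real.rpow_sub hd0]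
      congr 1
      ring
    have h2 : d ^ (-(M * (1 - s))) ≤ 9 ^ (M * (1 - s)) * (1 + d) ^ (-(M * (1 - s))) := by
      have h9 : (1 + d) / 9 ≤ d := by linarith
      refine (Real.rpow_le_rpow_of_nonpos (by positivity) h9 (by nlinarith)).trans_eq ?_
      rw [Real.div_rpow (by positivity) (by norm_num), Real.rpow_neg (by norm_num : (0 : ℝ) ≤ 9)]
      field_simp
    have h3 : (1 + d) ^ (-(M * (1 - s))) ≤ (1 + d) ^ (-(N + 1 : ℝ)) :=
      Real.rpow_le_rpow_of_exponent_le (by linarith) (by linarith)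
    calc volume.real K * C ^ 2 * (B * d ^ s) ^ M / d ^ M
        = volume.real K * C ^ 2 * B ^ M * ((d ^ s) ^ M / d ^ M) := by rw [mul_pow]; ring
      _ ≤ volume.real K * C ^ 2 * B ^ M *
          (9 ^ (M * (1 - s)) * (1 + d) ^ (-(N + 1 : ℝ))) := by
          rw [h1]
          refine mul_le_mul_of_nonneg_left (h2.trans ?_) (by positivity)
          gcongr
      _ = _ := by ring
  · have hf : (fun x => conj (D i l ν x)) = Complex.conjCLE ∘ D i l ν := rfl
    rw [hf, ContinuousLinearEquiv.comp_fderiv]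
    simp [hDd]
  · simp only [RCLike.norm_conj]
    refine (hCb i l hl ν x).trans ?_
    gcongr
    exact hR ξ ν hν hξ
  · refine (hCb i l hl μ x).trans ?_
    gcongr
    exact hR η μ hμ hη

variable {ι Γ : Type*} [Countable ι] [MeasurableSpace ι] [MeasurableSingletonClass ι] [Fintype Γ]

theorem hasSum_frozen {κ : (Fin N → ℝ) → ι} (hκ : Measurable κ) {a : ι → ℂ} {A : ℝ}
    (hA : ∀ ν, ‖a ν‖ ≤ A) {g : (Fin N → ℝ) → ℂ} (hg : Integrable g) (x : Fin N → ℝ) :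
    Integrable (fun ξ => charE x ξ * a (κ ξ) * g ξ) ∧
    HasSum (fun ν => a ν * invFourierT ((κ ⁻¹' {ν}).indicator g) x)
      (∫ ξ, charE x ξ * a (κ ξ) * g ξ) := by
  have hc : Continuous fun ξ : Fin N → ℝ => charE x ξ :=
    continuous_charE.comp (continuous_const.prodMk continuous_id)
  have hint : Integrable (fun ξ => charE x ξ * a (κ ξ) * g ξ) := by
    refine hg.bdd_mul (c := A) ?_ ?_
    · exact (hc.measurable.mul ((measurable_of_countable a).comp hκ)).aestronglyMeasurable
    · exact Eventually.of_forall fun ξ => by simpa using hA (κ ξ)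
  refine ⟨hint, ?_⟩
  have hm : ∀ ν, MeasurableSet (κ ⁻¹' {ν}) := fun ν => hκ (measurableSet_singleton ν)
  have h := hasSum_integral_iUnion (μ := volume) (s := fun ν => κ ⁻¹' {ν}) hm
    (fun ν μ hνμ => (Set.disjoint_singleton.2 hνμ).preimage κ) hint.integrableOn
  have hU : ⋃ ν, κ ⁻¹' {ν} = Set.univ := by ext ξ; simp
  rw [hU, setIntegral_univ] at h
  have he : (fun ν => a ν * invFourierT ((κ ⁻¹' {ν}).indicator g) x) =
      fun ν => ∫ ξ in κ ⁻¹' {ν}, charE x ξ * a (κ ξ) * g ξ := ?_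
  · rw [he]; exact h
  ext ν
  rw [← integral_indicator (hm ν)]
  unfold invFourierT
  rw [← integral_const_mul]
  congr 1
  ext ξ
  by_cases hξ : κ ξ = ν
  · rw [Set.indicator_of_mem (by exact hξ), Set.indicator_of_mem (by exact hξ), hξ, charE]
    ring
  · rw [Set.indicator_of_notMem (by exact hξ), Set.indicator_of_notMem (by exact hξ)]
    simp

/-- Almost orthogonality: `L²` boundedness of operators frozen on the cells of a partition. -/
theorem exists_eLpNorm_frozen_le {t δ : ℝ} (hδ0 : 0 ≤ δ) (hδt : δ < t)
    {κ : (Fin N → ℝ) → ι} (hκ : Measurable κ) {χ : ι → Γ}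
    (hχ : ∀ ξ η, κ ξ ≠ κ η → χ (κ ξ) = χ (κ η) → (1 + ‖ξ‖) ^ t ≤ 8 * ‖ξ - η‖)
    {c : ι → Fin N → ℝ} (hc : ∀ ξ, 1 + ‖c (κ ξ)‖ ≤ 2 * (1 + ‖ξ‖))
    {K : Set (Fin N → ℝ)} (hK : IsCompact K)
    {a : ι → (Fin N → ℝ) → ℂ} (hac : ∀ ν, Continuous (a ν)) (haz : ∀ ν x, x ∉ K → a ν x = 0)
    {A : ℝ} (hA : ∀ ν x, ‖a ν x‖ ≤ A)
    {D : Fin N → ℕ → ι → (Fin N → ℝ) → ℂ}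
    (hD0 : ∀ i ν, D i 0 ν = a ν) (hDc : ∀ i l ν, ContDiff ℝ 1 (D i l ν))
    (hDd : ∀ i l ν x, fderiv ℝ (D i l ν) x (Pi.single i 1) = D i (l + 1) ν x)
    (hDz : ∀ i l ν x, x ∉ K → D i l ν x = 0)
    (hDb : ∀ M : ℕ, ∃ C : ℝ, 0 ≤ C ∧ ∀ i, ∀ l ≤ M, ∀ ν x,
      ‖D i l ν x‖ ≤ C * ((1 + ‖c ν‖) ^ δ) ^ l) :
    ∃ C : ℝ, 0 ≤ C ∧ ∀ g : (Fin N → ℝ) → ℂ, Integrable g → MemLp g 2 →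
      AEStronglyMeasurable (fun x => ∫ ξ, charE x ξ * a (κ ξ) x * g ξ) volume ∧
      eLpNorm (fun x => ∫ ξ, charE x ξ * a (κ ξ) x * g ξ) 2 volume ≤
        ENNReal.ofReal C * eLpNorm g 2 volume := by
  classical
  obtain ⟨C, hC, hCb⟩ := exists_norm_integral_charE_le_rpow hδ0 hδt c hK hD0 hDc hDd hDz hDb
  set Φ : (Fin N → ℝ) → ℝ := fun z => C * (1 + ‖z‖) ^ (-(N + 1 : ℝ)) with hΦ
  have hΦi : Integrable Φ := (integrable_one_add_norm (by simp)).const_mul C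
  have hΦ0 : ∀ z, 0 ≤ Φ z := fun z => by positivity
  set S : ℝ := √(A ^ 2 + ∫ z, Φ z) with hS
  refine ⟨Fintype.card Γ * S, by positivity, fun g hg hg2 => ?_⟩
  have hm : ∀ ν, MeasurableSet (κ ⁻¹' {ν}) := fun ν => hκ (measurableSet_singleton ν)
  set u : ι → (Fin N → ℝ) → ℂ :=
    fun ν x => a ν x * invFourierT ((κ ⁻¹' {ν}).indicator g) x with hu
  have huc : ∀ ν, Continuous (u ν) := fun ν =>
    (hac ν).mul (continuous_invFourierT (hg.indicator (hm ν)))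
  have humem : ∀ ν, MemLp (u ν) 2 := fun ν =>
    (huc ν).memLp_of_hasCompactSupport
      (HasCompactSupport.intro hK fun x hx => by simp [hu, haz ν x hx])
  have hcol : ∀ (F : Finset ι) (γ : Γ), (∀ ν ∈ F, χ ν = γ) →
      eLpNorm (fun x => ∑ ν ∈ F, u ν x) 2 volume ≤ ENNReal.ofReal S * eLpNorm g 2 volume := by
    intro F γ hF
    have h := integral_norm_sq_sum_le F (Q := fun ν => κ ⁻¹' {ν}) hm
      (fun ν μ hνμ => (Set.disjoint_singleton.2 hνμ).preimage κ) hK hac haz hA hΦi hΦ0 ?_ hg hg2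
    · rw [eLpNorm_two_eq_ofReal_sqrt (memLp_finsetSum F fun ν _ => humem ν),
        eLpNorm_two_eq_ofReal_sqrt hg2, ← ENNReal.ofReal_mul (Real.sqrt_nonneg _),
        ← Real.sqrt_mul (add_nonneg (sq_nonneg A) (integral_nonneg hΦ0))]
      exact ENNReal.ofReal_le_ofReal (Real.sqrt_le_sqrt h)
    · rintro ν hν μ hμ hνμ ξ rfl η rfl
      have hcc := (hF _ hν).trans (hF _ hμ).symm
      refine hCb _ _ ξ η (hc ξ) (hc η) (hχ ξ η hνμ hcc) ?_
      rw [norm_sub_rev]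
      exact hχ η ξ hνμ.symm hcc.symm
  have hfin : ∀ F : Finset ι, eLpNorm (fun x => ∑ ν ∈ F, u ν x) 2 volume ≤
      ENNReal.ofReal (Fintype.card Γ * S) * eLpNorm g 2 volume := by
    intro F
    have h1 : (fun x => ∑ ν ∈ F, u ν x) =
        ∑ γ : Γ, fun x => ∑ ν ∈ F with χ ν = γ, u ν x := by
      ext x
      rw [Finset.sum_apply]
      exact (Finset.sum_fiberwise _ _ _).symm
    rw [h1]
    calc _ ≤ ∑ γ : Γ, eLpNorm (fun x => ∑ ν ∈ F with χ ν = γ, u ν x) 2 volume :=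
          eLpNorm_sum_le (fun γ _ =>
            (continuous_finsetSum _ fun ν _ => huc ν).aestronglyMeasurable) (by norm_num)
      _ ≤ ∑ _γ : Γ, ENNReal.ofReal S * eLpNorm g 2 volume :=
          Finset.sum_le_sum fun γ _ => hcol _ γ (by simp)
      _ = _ := by
          rw [ENNReal.ofReal_mul (by positivity)]
          simp [mul_assoc]
  obtain ⟨F, hF⟩ := Filter.exists_seq_tendsto (atTop : Filter (Finset ι))
  have hlim : ∀ x, Tendsto (fun n => ∑ ν ∈ F n, u ν x) atTop
      (nhds (∫ ξ, charE x ξ * a (κ ξ) x * g ξ)) := by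
    intro x
    have h := (hasSum_frozen hκ (fun ν => hA ν x) hg x).2
    rw [HasSum, SummationFilter.unconditional_filter] at h
    exact h.comp hF
  have hmeas : ∀ n, AEStronglyMeasurable (fun x => ∑ ν ∈ F n, u ν x) volume := fun n =>
    (continuous_finsetSum _ fun ν _ => huc ν).aestronglyMeasurable
  refine ⟨aestronglyMeasurable_of_tendsto_ae _ hmeas (Eventually.of_forall hlim), ?_⟩
  refine (Lp.eLpNorm_lim_le_liminf_eLpNorm hmeas _ (Eventually.of_forall hlim)).trans ?_
  exact (liminf_le_liminf (Eventually.of_forall fun n => hfin (F n))).trans_eq (liminf_const _)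

end Frozen

section Remainder

variable {N : ℕ}

/-- Operators whose symbols decay fast enough in frequency are bounded on `L²`. -/
theorem exists_eLpNorm_le_of_symbol_decay {K : Set (Fin N → ℝ)} (hK : IsCompact K) {s : ℝ}
    (hs : N < 2 * s) (B : ℝ) : ∃ C : ℝ, 0 ≤ C ∧ ∀ r : (Fin N → ℝ) → (Fin N → ℝ) → ℂ,
      (∀ x, x ∉ K → ∀ ξ, r x ξ = 0) → (∀ x ξ, ‖r x ξ‖ ≤ B * (1 + ‖ξ‖) ^ (-s)) →
      ∀ g : (Fin N → ℝ) → ℂ, MemLp g 2 →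
        eLpNorm (fun x => ∫ ξ, charE x ξ * r x ξ * g ξ) 2 volume ≤
          ENNReal.ofReal C * eLpNorm g 2 volume := by
  set w : (Fin N → ℝ) → ℝ := fun ξ => B * (1 + ‖ξ‖) ^ (-s) with hw
  have hwc : Continuous w := by
    refine continuous_const.mul (Continuous.rpow_const (by fun_prop) fun ξ => Or.inl ?_)
    positivity
  have hwm : MemLp w 2 := by
    rw [memLp_two_iff_integrable_sq hwc.aestronglyMeasurable]
    have : (fun ξ => w ξ ^ 2) = fun ξ : Fin N → ℝ => B ^ 2 * (1 + ‖ξ‖) ^ (-(2 * s)) := by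
      ext ξ
      have : (0 : ℝ) ≤ 1 + ‖ξ‖ := by positivity
      rw [hw, mul_pow, ← Real.rpow_natCast, ← Real.rpow_natCast, ← Real.rpow_mul this]
      congr 2
      push_cast
      ring
    rw [this]
    exact (integrable_one_add_norm (by simpa using hs)).const_mul _
  set V : ENNReal := volume K ^ (1 / 2 : ℝ) with hV
  have hVtop : V ≠ ⊤ := (ENNReal.rpow_lt_top_of_nonneg (by norm_num) hK.measure_lt_top.ne).ne
  refine ⟨(eLpNorm w 2 volume).toReal * V.toReal, by positivity, ?_⟩
  intro r hr0 hr g hg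
  set E : ENNReal := eLpNorm w 2 volume * eLpNorm g 2 volume with hE
  have hEtop : E ≠ ⊤ := ENNReal.mul_ne_top hwm.2.ne hg.2.ne
  have hpt : ∀ x, ‖∫ ξ, charE x ξ * r x ξ * g ξ‖ₑ ≤ E := by
    intro x
    refine (enorm_integral_le_lintegral_enorm _).trans ?_
    calc ∫⁻ ξ, ‖charE x ξ * r x ξ * g ξ‖ₑ ≤ ∫⁻ ξ, ‖(w • g) ξ‖ₑ := by
          refine lintegral_mono fun ξ => ?_
          rw [enorm_le_iff_norm_le]
          simp only [norm_mul, norm_charE, one_mul, Pi.smul_apply', norm_smul]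
          gcongr
          exact (hr x ξ).trans (le_abs_self _)
      _ = eLpNorm (w • g) 1 volume := eLpNorm_one_eq_lintegral_enorm.symm
      _ ≤ E := eLpNorm_smul_le_mul_eLpNorm hg.1 hwm.1
  calc eLpNorm (fun x => ∫ ξ, charE x ξ * r x ξ * g ξ) 2 volume
      ≤ eLpNorm (K.indicator fun _ => E.toReal) 2 volume := by
        refine eLpNorm_mono fun x => ?_
        by_cases hx : x ∈ K
        · rw [Set.indicator_of_mem hx, ← enorm_le_iff_norm_le]
          refine (hpt x).trans_eq ?_
          rw [Real.enorm_of_nonneg ENNReal.toReal_nonneg, ENNReal.ofReal_toReal hEtop]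
        · simp [hr0 x hx]
    _ = E * V := by
        rw [eLpNorm_indicator_const hK.measurableSet (by norm_num) (by norm_num),
          Real.enorm_of_nonneg ENNReal.toReal_nonneg, ENNReal.ofReal_toReal hEtop]
        simp [hV]
    _ = _ := by
        rw [ENNReal.ofReal_mul ENNReal.toReal_nonneg, ENNReal.ofReal_toReal hwm.2.ne,
          ENNReal.ofReal_toReal hVtop, hE]
        ring

end Remainder

section Symbol

variable {N : ℕ} {ρ δ : ℝ} {σ : (Fin N → ℝ) → (Fin N → ℝ) → ℂ}

theorem IsHormanderSymbol.contDiff {m : ℝ} (hσ : IsHormanderSymbol ρ δ m Set.univ σ) :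
    ContDiff ℝ ∞ fun p : (Fin N → ℝ) × (Fin N → ℝ) => σ p.1 p.2 := by
  have h := hσ.1
  rwa [Set.univ_prod_univ, contDiffOn_univ] at h

theorem IsHormanderSymbol.exists_norm_symbolDeriv_le
    (hσ : IsHormanderSymbol ρ δ 0 Set.univ σ) {K : Set (Fin N → ℝ)} (hK : IsCompact K)
    (hσ0 : ∀ x, x ∉ K → ∀ ξ, σ x ξ = 0) (Lx Lθ : List (Fin N)) :
    ∃ C : ℝ, 0 ≤ C ∧ ∀ x θ, ‖symbolDeriv Lx Lθ σ x θ‖ ≤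
      C * (1 + ‖θ‖) ^ (-(ρ * Lθ.length) + δ * Lx.length) := by
  obtain ⟨C, hC, hb⟩ := hσ.2 K (Set.subset_univ K) hK Lx Lθ
  set s : ℝ := -(ρ * Lθ.length) + δ * Lx.length with hs
  refine ⟨C * 2 ^ |s|, by positivity, fun x θ => ?_⟩
  by_cases hx : x ∈ K
  · refine (hb x hx θ).trans ?_
    rw [mul_assoc, zero_sub]
    exact mul_le_mul_of_nonneg_left (jweight_le_rpow s θ) hC
  · rw [symbolDeriv_eq_zero_of_notMem hK.isClosed Lx Lθ hσ0 x hx θ, norm_zero]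
    positivity

/-- `L²` boundedness of a single term of the Taylor expansion of the symbol at the
representative points of the cells. -/
theorem IsHormanderSymbol.exists_eLpNorm_taylorTerm_le
    (hσ : IsHormanderSymbol ρ δ 0 Set.univ σ) {K : Set (Fin N → ℝ)} (hK : IsCompact K)
    (hσ0 : ∀ x, x ∉ K → ∀ ξ, σ x ξ = 0) {t : ℝ} (hδ0 : 0 ≤ δ) (hδt : δ < t)
    {ι Γ : Type*} [Countable ι] [MeasurableSpace ι] [MeasurableSingletonClass ι] [Fintype Γ]
    {κ : (Fin N → ℝ) → ι} (hκ : Measurable κ) {χ : ι → Γ}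
    (hχ : ∀ ξ η, κ ξ ≠ κ η → χ (κ ξ) = χ (κ η) → (1 + ‖ξ‖) ^ t ≤ 8 * ‖ξ - η‖)
    {c : ι → Fin N → ℝ} (hc : ∀ ξ, 1 + ‖c (κ ξ)‖ ≤ 2 * (1 + ‖ξ‖))
    (hcv : ∀ ξ, ‖ξ - c (κ ξ)‖ ≤ (1 + ‖c (κ ξ)‖) ^ ρ) (k : ℕ) (L : Fin k → Fin N) :
    ∃ C : ℝ, 0 ≤ C ∧ ∀ g : (Fin N → ℝ) → ℂ, Integrable g → MemLp g 2 →
      (∀ x, Integrable fun ξ => charE x ξ * ((((k.factorial : ℝ)⁻¹ *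
        ∏ i, (ξ - c (κ ξ)) (L i) : ℝ) : ℂ) * symbolDeriv [] (List.ofFn L) σ x (c (κ ξ))) * g ξ) ∧
      AEStronglyMeasurable (fun x => ∫ ξ, charE x ξ * ((((k.factorial : ℝ)⁻¹ *
        ∏ i, (ξ - c (κ ξ)) (L i) : ℝ) : ℂ) *
          symbolDeriv [] (List.ofFn L) σ x (c (κ ξ))) * g ξ) volume ∧
      eLpNorm (fun x => ∫ ξ, charE x ξ * ((((k.factorial : ℝ)⁻¹ *
        ∏ i, (ξ - c (κ ξ)) (L i) : ℝ) : ℂ) *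
          symbolDeriv [] (List.ofFn L) σ x (c (κ ξ))) * g ξ) 2 volume ≤
        ENNReal.ofReal C * eLpNorm g 2 volume := by
  have hWpos : ∀ ν, 0 < 1 + ‖c ν‖ := fun ν => by positivity
  set w : ι → ℝ := fun ν => ((1 + ‖c ν‖) ^ ρ) ^ k with hw
  have hw0 : ∀ ν, 0 < w ν := fun ν => by have := hWpos ν; positivity
  set D : Fin N → ℕ → ι → (Fin N → ℝ) → ℂ := fun i l ν x =>
    (w ν : ℂ) * symbolDeriv (List.replicate l i) (List.ofFn L) σ x (c ν) with hD
  set a : ι → (Fin N → ℝ) → ℂ := fun ν x =>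
    (w ν : ℂ) * symbolDeriv [] (List.ofFn L) σ x (c ν) with ha
  have hsm : ∀ (Lx : List (Fin N)) ν, ContDiff ℝ ∞ fun x =>
      symbolDeriv Lx (List.ofFn L) σ x (c ν) := fun Lx ν =>
    (contDiff_symbolDeriv Lx (List.ofFn L) hσ.contDiff).comp (contDiff_id.prodMk contDiff_const)
  have hbound : ∀ (Lx : List (Fin N)), ∃ C : ℝ, 0 ≤ C ∧ ∀ ν x,
      ‖(w ν : ℂ) * symbolDeriv Lx (List.ofFn L) σ x (c ν)‖ ≤
        C * ((1 + ‖c ν‖) ^ δ) ^ Lx.length := by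
    intro Lx
    obtain ⟨C, hC, hb⟩ := hσ.exists_norm_symbolDeriv_le hK hσ0 Lx (List.ofFn L)
    refine ⟨C, hC, fun ν x => ?_⟩
    rw [norm_mul, Complex.norm_real, Real.norm_of_nonneg (hw0 ν).le]
    refine (mul_le_mul_of_nonneg_left (hb x (c ν)) (hw0 ν).le).trans_eq ?_
    rw [hw, List.length_ofFn, Real.rpow_add (hWpos ν), Real.rpow_neg (hWpos ν).le,
      Real.rpow_mul (hWpos ν).le, Real.rpow_mul (hWpos ν).le, Real.rpow_natCast,
      Real.rpow_natCast]
    have : ((1 + ‖c ν‖) ^ ρ) ^ k ≠ 0 := (hw0 ν).ne'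
    field_simp
  obtain ⟨A, -, hA⟩ := hbound []
  simp only [List.length_nil, pow_zero, mul_one] at hA
  choose Cb hCb0 hCb using fun (i : Fin N) (l : ℕ) => hbound (List.replicate l i)
  obtain ⟨C, hC, hCfin⟩ := exists_eLpNorm_frozen_le hδ0 hδt hκ hχ hc hK (a := a) (D := D)
    (fun ν => continuous_const.mul (hsm [] ν).continuous)
    (fun ν x hx => by
      simp [ha, symbolDeriv_eq_zero_of_notMem hK.isClosed [] (List.ofFn L) hσ0 x hx])
    hA (fun i ν => rfl)
    (fun i l ν => contDiff_const.mul ((hsm _ ν).of_le (by simp)))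
    (fun i l ν x => by
      have hd : DifferentiableAt ℝ (fun x =>
        symbolDeriv (List.replicate l i) (List.ofFn L) σ x (c ν)) x :=
        (hsm _ ν).differentiable (by simp) x
      simp only [hD]
      rw [fderiv_const_mul hd]
      rfl)
    (fun i l ν x hx => by
      simp [hD, symbolDeriv_eq_zero_of_notMem hK.isClosed _ (List.ofFn L) hσ0 x hx])
    (fun M => ⟨∑ i, ∑ l ∈ Finset.range (M + 1), Cb i l,
      Finset.sum_nonneg fun i _ => Finset.sum_nonneg fun l _ => hCb0 i l, fun i l hl ν x => by
        have h := hCb i l ν x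
        rw [List.length_replicate] at h
        refine h.trans (mul_le_mul_of_nonneg_right ?_ (by have := hWpos ν; positivity))
        calc Cb i l ≤ ∑ l ∈ Finset.range (M + 1), Cb i l :=
              Finset.single_le_sum (f := fun l => Cb i l) (fun l _ => hCb0 i l)
                (Finset.mem_range.2 (by omega))
          _ ≤ _ := Finset.single_le_sum (f := fun i => ∑ l ∈ Finset.range (M + 1), Cb i l)
                (fun i _ => Finset.sum_nonneg fun l _ => hCb0 i l) (Finset.mem_univ i)⟩)
  refine ⟨C, hC, fun g hg hg2 => ?_⟩
  set m : (Fin N → ℝ) → ℝ := fun ξ =>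
    (k.factorial : ℝ)⁻¹ * (∏ i, (ξ - c (κ ξ)) (L i)) * (w (κ ξ))⁻¹ with hm
  have hmm : Measurable m := by
    have h1 : Measurable fun ξ => c (κ ξ) := (measurable_of_countable c).comp hκ
    have h2 : Measurable fun ξ => w (κ ξ) := (measurable_of_countable w).comp hκ
    refine (measurable_const.mul (Finset.measurable_prod _ fun i _ => ?_)).mul h2.inv
    exact (measurable_pi_apply (L i)).comp (measurable_id.sub h1)
  have hm1 : ∀ ξ, ‖(m ξ : ℂ)‖ ≤ 1 := by
    intro ξ
    rw [Complex.norm_real, hm]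
    simp only [norm_mul, norm_inv, norm_prod]
    rw [Real.norm_of_nonneg (hw0 _).le, Real.norm_of_nonneg (by positivity), ← div_eq_mul_inv,
      div_le_one (hw0 _)]
    have h1 : ((k.factorial : ℝ))⁻¹ ≤ 1 :=
      inv_le_one_of_one_le₀ (by exact_mod_cast Nat.one_le_iff_ne_zero.2 k.factorial_ne_zero)
    have h2 : ∏ i, ‖(ξ - c (κ ξ)) (L i)‖ ≤ w (κ ξ) := by
      calc ∏ i, ‖(ξ - c (κ ξ)) (L i)‖ ≤ ∏ _i : Fin k, (1 + ‖c (κ ξ)‖) ^ ρ :=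
            Finset.prod_le_prod (fun _ _ => norm_nonneg _) fun i _ =>
              (norm_le_pi_norm _ _).trans (hcv ξ)
        _ = w (κ ξ) := by simp [hw]
    calc _ ≤ 1 * ∏ i, ‖(ξ - c (κ ξ)) (L i)‖ := by gcongr
      _ ≤ _ := by rwa [one_mul]
  set h : (Fin N → ℝ) → ℂ := fun ξ => (m ξ : ℂ) * g ξ with hh
  have hhm : AEStronglyMeasurable (fun ξ => (m ξ : ℂ)) volume :=
    (Complex.measurable_ofReal.comp hmm).aestronglyMeasurable
  have hle : ∀ ξ, ‖h ξ‖ ≤ ‖g ξ‖ := fun ξ => by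
    rw [hh, norm_mul]
    exact mul_le_of_le_one_left (norm_nonneg _) (hm1 ξ)
  have hhi : Integrable h := hg.mono (hhm.mul hg.1) (Eventually.of_forall hle)
  have hh2 : MemLp h 2 := hg2.mono (hhm.mul hg.1) (Eventually.of_forall hle)
  have hcongr : ∀ x ξ, charE x ξ * ((((k.factorial : ℝ)⁻¹ *
      ∏ i, (ξ - c (κ ξ)) (L i) : ℝ) : ℂ) * symbolDeriv [] (List.ofFn L) σ x (c (κ ξ))) * g ξ =
      charE x ξ * a (κ ξ) x * h ξ := by
    intro x ξ
    have hwc : (w (κ ξ) : ℂ) ≠ 0 := by exact_mod_cast (hw0 _).ne'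
    simp only [ha, hh, hm]
    push_cast
    field_simp
  simp only [hcongr]
  obtain ⟨h1, h2⟩ := hCfin h hhi hh2
  refine ⟨fun x => (hasSum_frozen hκ (fun ν => hA ν x) hhi x).1, h1, h2.trans ?_⟩
  gcongr
  exact eLpNorm_mono hle

end Symbol

section Main

variable {N : ℕ} {ρ δ : ℝ} {σ : (Fin N → ℝ) → (Fin N → ℝ) → ℂ}

/-- Decay of the Taylor remainder of an order zero symbol at nearby points. -/
theorem IsHormanderSymbol.exists_norm_sub_taylor_le
    (hσ : IsHormanderSymbol ρ δ 0 Set.univ σ) {K : Set (Fin N → ℝ)} (hK : IsCompact K)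
    (hσ0 : ∀ x, x ∉ K → ∀ ξ, σ x ξ = 0) {t : ℝ} (hρ0 : 0 ≤ ρ) (ht1 : t ≤ 1) (M : ℕ) :
    ∃ C : ℝ, 0 ≤ C ∧ ∀ x ξ c, ‖ξ - c‖ ≤ (1 + ‖ξ‖) ^ t / 4 →
      ‖σ x ξ - ∑ k ∈ Finset.range M, ∑ L : Fin k → Fin N,
        (((k.factorial : ℝ)⁻¹ * ∏ i, (ξ - c) (L i) : ℝ) : ℂ) *
          symbolDeriv [] (List.ofFn L) σ x c‖ ≤ C * (1 + ‖ξ‖) ^ (-((ρ - t) * M)) := by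
  choose Cb hCb0 hCb using fun L : Fin M → Fin N =>
    hσ.exists_norm_symbolDeriv_le hK hσ0 [] (List.ofFn L)
  set S : ℝ := ∑ L, Cb L with hS
  have hS0 : 0 ≤ S := Finset.sum_nonneg fun L _ => hCb0 L
  refine ⟨(N : ℝ) ^ M * (S * 2 ^ (ρ * M)), by positivity, fun x ξ c hc => ?_⟩
  have hW : 0 < 1 + ‖ξ‖ := by positivity
  have hW1 : (1 : ℝ) ≤ 1 + ‖ξ‖ := by linarith [norm_nonneg ξ]
  have hWt : (1 + ‖ξ‖) ^ t ≤ 1 + ‖ξ‖ := by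
    simpa using Real.rpow_le_rpow_of_exponent_le hW1 ht1
  refine (norm_symbol_sub_taylor_le hσ.contDiff x c ξ M
    (B := S * (2 ^ (ρ * M) * (1 + ‖ξ‖) ^ (-(ρ * M)))) ?_).trans ?_
  · intro L τ hτ
    have h := hCb L x (c + τ • (ξ - c))
    simp only [List.length_ofFn, List.length_nil, Nat.cast_zero, mul_zero, add_zero] at h
    refine h.trans (mul_le_mul (Finset.single_le_sum (f := Cb) (fun L _ => hCb0 L)
      (Finset.mem_univ L)) ?_ (by positivity) hS0)
    have hdist : ‖ξ‖ ≤ ‖c + τ • (ξ - c)‖ + (1 + ‖ξ‖) / 4 := by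
      have h1 : ξ = (c + τ • (ξ - c)) + (1 - τ) • (ξ - c) := by
        rw [sub_smul, one_smul]; abel
      calc ‖ξ‖ = ‖(c + τ • (ξ - c)) + (1 - τ) • (ξ - c)‖ := by rw [← h1]
        _ ≤ ‖c + τ • (ξ - c)‖ + ‖(1 - τ) • (ξ - c)‖ := norm_add_le _ _
        _ ≤ _ := by
            rw [norm_smul, Real.norm_of_nonneg (by linarith [hτ.2])]
            have := mul_le_of_le_one_left (norm_nonneg (ξ - c)) (by linarith [hτ.1] : 1 - τ ≤ 1)
            linarith
    have h2 : (1 + ‖ξ‖) / 2 ≤ 1 + ‖c + τ • (ξ - c)‖ := by linarith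
    have hneg : -(ρ * M) ≤ 0 := by
      have : 0 ≤ ρ * M := by positivity
      linarith
    refine (Real.rpow_le_rpow_of_nonpos (by positivity) h2 hneg).trans_eq ?_
    rw [Real.div_rpow hW.le (by norm_num), Real.rpow_neg (by norm_num : (0 : ℝ) ≤ 2)]
    field_simp
  · have h1 : ‖ξ - c‖ ^ M ≤ (1 + ‖ξ‖) ^ (t * M) := by
      rw [Real.rpow_mul hW.le, Real.rpow_natCast]
      have : 0 ≤ (1 + ‖ξ‖) ^ t := by positivity
      gcongr
      linarith
    calc (N : ℝ) ^ M * ‖ξ - c‖ ^ M * (S * (2 ^ (ρ * M) * (1 + ‖ξ‖) ^ (-(ρ * M))))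
        ≤ (N : ℝ) ^ M * (1 + ‖ξ‖) ^ (t * M) *
          (S * (2 ^ (ρ * M) * (1 + ‖ξ‖) ^ (-(ρ * M)))) := by gcongr
      _ = (N : ℝ) ^ M * (S * 2 ^ (ρ * M)) *
          ((1 + ‖ξ‖) ^ (t * M) * (1 + ‖ξ‖) ^ (-(ρ * M))) := by ring
      _ = _ := by
          rw [← Real.rpow_add hW]
          congr 2
          ring

theorem aestronglyMeasurable_pdoApply
    (hσ : Continuous fun p : (Fin N → ℝ) × (Fin N → ℝ) => σ p.1 p.2) {f : (Fin N → ℝ) → ℂ}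
    (hf : Integrable f) : AEStronglyMeasurable (pdoApply σ f) volume := by
  have h : Continuous fun p : (Fin N → ℝ) × (Fin N → ℝ) =>
      charE p.1 p.2 * σ p.1 p.2 * fourierT f p.2 :=
    (continuous_charE.mul hσ).mul ((continuous_fourierT hf).comp continuous_snd)
  exact (h.stronglyMeasurable.integral_prod_right (ν := volume)).aestronglyMeasurable

end Main

/-- first part of Proposition 5.2: L² boundedness of compactly supported
order-zero pseudodifferential operators: if `σ ∈ S^0_{ρ,δ}(ℝ^N × ℝ^N)` vanishes for `x`
outside a compact set `K₀`, then there is `C ≥ 0` with `‖A_σ f‖_{L²} ≤ C ‖f‖_{L²}` for all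
Schwartz `f`; hence `A_σ` extends to a bounded operator on `L²(ℝ^N)`. -/
theorem pdo_L2_bounded {N : ℕ} (hN : 1 ≤ N)
    (ρ δ : ℝ) (hδ0 : 0 ≤ δ) (hδρ : δ < ρ) (hρ1 : ρ ≤ 1)
    (σ : (Fin N → ℝ) → (Fin N → ℝ) → ℂ)
    (hσ : IsHormanderSymbol ρ δ 0 Set.univ σ)
    (K₀ : Set (Fin N → ℝ)) (hK₀ : IsCompact K₀)
    (hσsupp : ∀ x : Fin N → ℝ, x ∉ K₀ → ∀ ξ : Fin N → ℝ, σ x ξ = 0) :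
    ∃ C : ℝ, 0 ≤ C ∧ ∀ f : SchwartzMap (Fin N → ℝ) ℂ,
      eLpNorm (pdoApply σ ⇑f) 2 volume ≤ ENNReal.ofReal C * eLpNorm ⇑f 2 volume := by
  set t : ℝ := (δ + ρ) / 2 with ht
  have hδt : δ < t := by linarith
  have htρ : t < ρ := by linarith
  have ht0 : 0 ≤ t := by linarith
  have ht1 : t ≤ 1 := by linarith
  have hρ0 : 0 ≤ ρ := by linarith
  obtain ⟨κ, χ, hκ, hκd, hχ⟩ := exists_cells N ht0 ht1
  set c : ℕ × (Fin N → ℤ) → Fin N → ℝ := Function.invFun κ with hc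
  have hκc : ∀ ξ, κ (c (κ ξ)) = κ ξ := fun ξ => Function.invFun_eq ⟨ξ, rfl⟩
  have hdist : ∀ ξ, ‖ξ - c (κ ξ)‖ ≤ (1 + ‖ξ‖) ^ t / 4 := fun ξ => hκd ξ _ (hκc ξ).symm
  have hdist1 : ∀ ξ, ‖ξ - c (κ ξ)‖ ≤ (1 + ‖ξ‖) / 4 := fun ξ => by
    have h1 : (1 + ‖ξ‖) ^ t ≤ 1 + ‖ξ‖ := by
      simpa using Real.rpow_le_rpow_of_exponent_le
        (by linarith [norm_nonneg ξ] : (1 : ℝ) ≤ 1 + ‖ξ‖) ht1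
    linarith [hdist ξ]
  have hcW : ∀ ξ, 1 + ‖c (κ ξ)‖ ≤ 2 * (1 + ‖ξ‖) := fun ξ => by
    have h1 := norm_sub_norm_le (c (κ ξ)) ξ
    rw [norm_sub_rev] at h1
    linarith [hdist1 ξ, norm_nonneg ξ]
  have hcv : ∀ ξ, ‖ξ - c (κ ξ)‖ ≤ (1 + ‖c (κ ξ)‖) ^ ρ := fun ξ => by
    have h1 : 1 + ‖ξ‖ ≤ 4 * (1 + ‖c (κ ξ)‖) := by
      linarith [norm_sub_norm_le ξ (c (κ ξ)), hdist1 ξ, norm_nonneg ξ]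
    have h2 : (1 + ‖ξ‖) ^ t ≤ 4 * (1 + ‖c (κ ξ)‖) ^ ρ := by
      calc (1 + ‖ξ‖) ^ t ≤ (4 * (1 + ‖c (κ ξ)‖)) ^ t :=
            Real.rpow_le_rpow (by positivity) h1 ht0
        _ = 4 ^ t * (1 + ‖c (κ ξ)‖) ^ t := Real.mul_rpow (by norm_num) (by positivity)
        _ ≤ 4 * (1 + ‖c (κ ξ)‖) ^ ρ := by
            refine mul_le_mul ?_ ?_ (by positivity) (by norm_num)
            · simpa using Real.rpow_le_rpow_of_exponent_le (by norm_num : (1 : ℝ) ≤ 4) ht1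
            · exact Real.rpow_le_rpow_of_exponent_le
                (by linarith [norm_nonneg (c (κ ξ))]) htρ.le
    linarith [hdist ξ]
  obtain ⟨M, hM⟩ := exists_nat_gt ((N : ℝ) / (2 * (ρ - t)))
  rw [div_lt_iff₀ (by linarith)] at hM
  obtain ⟨B, -, hB⟩ := hσ.exists_norm_sub_taylor_le hK₀ hσsupp hρ0 ht1 M
  obtain ⟨C₁, hC₁, hrem⟩ := exists_eLpNorm_le_of_symbol_decay hK₀ (s := (ρ - t) * M)
    (by linarith) B
  choose C₂ hC₂ hterm using fun (k : ℕ) (L : Fin k → Fin N) =>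
    hσ.exists_eLpNorm_taylorTerm_le hK₀ hσsupp hδ0 hδt hκ hχ hcW hcv k L
  obtain ⟨A, -, hA⟩ := hσ.exists_norm_symbolDeriv_le hK₀ hσsupp [] []
  have hS0 : 0 ≤ ∑ k ∈ Finset.range M, ∑ L : Fin k → Fin N, C₂ k L :=
    Finset.sum_nonneg fun k _ => Finset.sum_nonneg fun L _ => hC₂ k L
  refine ⟨C₁ + ∑ k ∈ Finset.range M, ∑ L : Fin k → Fin N, C₂ k L, by positivity, fun f => ?_⟩
  have hfi : Integrable ⇑f := f.integrable
  have hf2 : MemLp ⇑f 2 := f.memLp 2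
  rw [← eLpNorm_fourierT hfi hf2]
  have hgi := integrable_fourierT f
  have hg2 : MemLp (fourierT ⇑f) 2 :=
    ⟨hgi.1, by rw [eLpNorm_fourierT hfi hf2]; exact hf2.2⟩
  have hpm : AEStronglyMeasurable (pdoApply σ ⇑f) volume :=
    aestronglyMeasurable_pdoApply hσ.contDiff.continuous hfi
  set g := fourierT ⇑f with hg
  set b : (k : ℕ) → (Fin k → Fin N) → (Fin N → ℝ) → (Fin N → ℝ) → ℂ := fun k L x ξ =>
    (((k.factorial : ℝ)⁻¹ * ∏ i, (ξ - c (κ ξ)) (L i) : ℝ) : ℂ) *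
      symbolDeriv [] (List.ofFn L) σ x (c (κ ξ)) with hb
  set T : (k : ℕ) → (Fin k → Fin N) → (Fin N → ℝ) → ℂ := fun k L x =>
    ∫ ξ, charE x ξ * b k L x ξ * g ξ with hT
  set r : (Fin N → ℝ) → (Fin N → ℝ) → ℂ := fun x ξ =>
    σ x ξ - ∑ k ∈ Finset.range M, ∑ L : Fin k → Fin N, b k L x ξ with hr
  have hr0 : ∀ x, x ∉ K₀ → ∀ ξ, r x ξ = 0 := fun x hx ξ => by
    simp [hr, hb, hσsupp x hx ξ,
      fun k L => symbolDeriv_eq_zero_of_notMem hK₀.isClosed [] (List.ofFn (n := k) L) hσsupp x hx]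
  have hR := hrem r hr0 (fun x ξ => hB x ξ _ (hdist ξ)) g hg2
  have hsplit : ∀ x, ∫ ξ, charE x ξ * r x ξ * g ξ =
      pdoApply σ ⇑f x - ∑ k ∈ Finset.range M, ∑ L : Fin k → Fin N, T k L x := by
    intro x
    have hσi : Integrable fun ξ => charE x ξ * σ x ξ * g ξ := by
      refine hgi.bdd_mul (c := A) ?_ (Eventually.of_forall fun ξ => ?_)
      · exact ((continuous_charE.mul hσ.contDiff.continuous).comp
          (continuous_const.prodMk continuous_id)).aestronglyMeasurable
      · simpa [symbolDeriv] using hA x ξ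
    have hbi := fun k L => (hterm k L g hgi hg2).1 x
    have he : ∀ ξ, charE x ξ * r x ξ * g ξ = charE x ξ * σ x ξ * g ξ -
        ∑ k ∈ Finset.range M, ∑ L : Fin k → Fin N, charE x ξ * b k L x ξ * g ξ := by
      intro ξ
      simp only [hr, mul_sub, sub_mul, Finset.mul_sum, Finset.sum_mul]
    simp_rw [he]
    rw [integral_sub hσi (integrable_finsetSum _ fun k _ => integrable_finsetSum _ fun L _ =>
        hbi k L), integral_finsetSum _ fun k _ => integrable_finsetSum _ fun L _ => hbi k L]
    congr 1
    refine Finset.sum_congr rfl fun k _ => ?_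
    rw [integral_finsetSum _ fun L _ => hbi k L]
  have hTm : ∀ k L, AEStronglyMeasurable (T k L) volume := fun k L => (hterm k L g hgi hg2).2.1
  have hTs : ∀ k, AEStronglyMeasurable (∑ L, T k L) volume := fun k =>
    Finset.aestronglyMeasurable_sum _ fun L _ => hTm k L
  have hTss : AEStronglyMeasurable (∑ k ∈ Finset.range M, ∑ L, T k L) volume :=
    Finset.aestronglyMeasurable_sum _ fun k _ => hTs k
  set R : (Fin N → ℝ) → ℂ := fun x => ∫ ξ, charE x ξ * r x ξ * g ξ with hRdef
  have hRe : R = pdoApply σ ⇑f - ∑ k ∈ Finset.range M, ∑ L, T k L := by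
    ext x
    simp [hRdef, hsplit x, Finset.sum_apply]
  have hRm : AEStronglyMeasurable R volume := by
    rw [hRe]
    exact hpm.sub hTss
  have hdec : pdoApply σ ⇑f = R + ∑ k ∈ Finset.range M, ∑ L, T k L := by
    rw [hRe, sub_add_cancel]
  rw [hdec]
  calc eLpNorm (R + ∑ k ∈ Finset.range M, ∑ L, T k L) 2 volume
      ≤ eLpNorm R 2 volume + eLpNorm (∑ k ∈ Finset.range M, ∑ L, T k L) 2 volume :=
        eLpNorm_add_le hRm hTss (by norm_num)
    _ ≤ ENNReal.ofReal C₁ * eLpNorm g 2 volume + ∑ k ∈ Finset.range M, ∑ L : Fin k → Fin N,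
        ENNReal.ofReal (C₂ k L) * eLpNorm g 2 volume := by
        refine add_le_add hR ((eLpNorm_sum_le (fun k _ => hTs k) (by norm_num)).trans ?_)
        refine Finset.sum_le_sum fun k _ =>
          (eLpNorm_sum_le (fun L _ => hTm k L) (by norm_num)).trans ?_
        exact Finset.sum_le_sum fun L _ => (hterm k L g hgi hg2).2.2
    _ = _ := by
        rw [ENNReal.ofReal_add hC₁ hS0, add_mul, ENNReal.ofReal_sum_of_nonneg fun k _ =>
          Finset.sum_nonneg fun L _ => hC₂ k L, Finset.sum_mul]
        congr 1
        refine Finset.sum_congr rfl fun k _ => ?_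
        rw [ENNReal.ofReal_sum_of_nonneg fun L _ => hC₂ k L, Finset.sum_mul]
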